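/- arXiv:1811.11240 — 2 statements merged into one kernel-verified Lean document; each statement's English description precedes it below -/
import Mathlib

section
/- Let 0 < α < 2. For every ε > 0, every collection of distinct real numbers E_1, …, E_N, and every θ_1, …, θ_N ∈ [0,π], there exists a locally L¹ potential q on [0,∞) such that limsup_{x→∞} x^{1-α/2}|q(x)| ≤ (2-α+ε) N and, for each j = 1, …, N, the equation -u''(x) - x^α u(x) + q(x)u(x) = E_j u(x) has a nonzero solution u with ∫₀^∞ |u(x)|² dx < ∞ satisfying the boundary condition u'(0) cos θ_j = u(0) sin θ_j. -/
open Filter MeasureTheory Set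

open scoped NNReal in
/-- A globally Lipschitz time-dependent vector field that is bounded on bounded time intervals has
a global integral curve through every point. -/
theorem exists_global_integralCurve {V : Type*} [NormedAddCommGroup V] [NormedSpace ℝ V]
    [CompleteSpace V] {v : ℝ → V → V} {K : ℝ≥0} (hlip : ∀ t, LipschitzWith K (v t))
    (hcont : ∀ y, Continuous fun t => v t y)
    (hbdd : ∀ T : ℝ, ∃ L : ℝ≥0, ∀ t ∈ Icc (-T) T, ∀ y, ‖v t y‖ ≤ L) (y₀ : V) :
    ∃ φ : ℝ → V, φ 0 = y₀ ∧ ∀ t, HasDerivAt φ (v t (φ t)) t := by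
  have hloc : ∀ n : ℕ, ∃ φ : ℝ → V, φ 0 = y₀ ∧
      ∀ t ∈ Ioo (-(n + 1 : ℝ)) (n + 1), HasDerivAt φ (v t (φ t)) t := by
    intro n
    obtain ⟨L, hL⟩ := hbdd (n + 1)
    have h0 : (0 : ℝ) ∈ Icc (-(n + 1 : ℝ)) (n + 1) := ⟨by linarith [n.cast_nonneg (α := ℝ)],
      by positivity⟩
    have hPL : IsPicardLindelof v (⟨0, h0⟩ : Icc (-(n + 1 : ℝ)) (n + 1)) y₀ (L * (n + 1)) 0 L K :=
      { lipschitzOnWith := fun t _ => (hlip t).lipschitzOnWith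
        continuousOn := fun y _ => (hcont y).continuousOn
        norm_le := fun t ht y _ => hL t ht y
        mul_max_le := by simp }
    obtain ⟨φ, hφ0, hφ⟩ := hPL.exists_eq_forall_mem_Icc_hasDerivWithinAt₀
    exact ⟨φ, hφ0, fun t ht => (hφ t (Ioo_subset_Icc_self ht)).hasDerivAt (Icc_mem_nhds ht.1 ht.2)⟩
  choose φ hφ0 hφ using hloc
  have hmono : ∀ m n : ℕ, m ≤ n → EqOn (φ m) (φ n) (Ioo (-(m + 1 : ℝ)) (m + 1)) := by
    intro m n hmn
    have hmn' : (m : ℝ) ≤ n := by exact_mod_cast hmn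
    refine ODE_solution_unique_of_mem_Ioo (v := v) (s := fun _ => univ) (K := K) (t₀ := 0)
      (fun t _ => (hlip t).lipschitzOnWith) ⟨by linarith [m.cast_nonneg (α := ℝ)], by positivity⟩
      (fun t ht => ⟨hφ m t ht, trivial⟩) (fun t ht => ⟨hφ n t ⟨?_, ?_⟩, trivial⟩) ?_
    · linarith [ht.1]
    · linarith [ht.2]
    · rw [hφ0, hφ0]
  have hagree : ∀ m n : ℕ, ∀ t : ℝ, |t| < m + 1 → |t| < n + 1 → φ m t = φ n t := by
    intro m n t hm hn
    rcases le_total m n with h | h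
    · exact hmono m n h (abs_lt.1 hm)
    · exact (hmono n m h (abs_lt.1 hn)).symm
  refine ⟨fun t => φ ⌈|t|⌉₊ t, by simp [hφ0], fun t => ?_⟩
  set n := ⌈|t|⌉₊ + 1 with hn
  have hceil : ∀ s : ℝ, |s| < ⌈|s|⌉₊ + 1 := fun s => (Nat.le_ceil _).trans_lt (lt_add_one _)
  have htn : |t| < (n : ℝ) + 1 := by
    have := hceil t
    push_cast [hn]
    linarith
  have heq : (fun s => φ ⌈|s|⌉₊ s) =ᶠ[nhds t] φ n := by
    filter_upwards [(continuous_abs.tendsto t).eventually_lt_const htn] with s hs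
    exact hagree _ _ s (hceil s) hs
  have := (hφ n t (abs_lt.1 htn)).congr_of_eventuallyEq heq
  rwa [← heq.eq_of_nhds] at this

/-- The smooth weight `√(M + x²)`, a regularization of `|x|`. -/
noncomputable def weight (M x : ℝ) : ℝ := √(M + x ^ 2)

section Weight

variable {M : ℝ}

theorem sq_weight (hM : 1 ≤ M) (x : ℝ) : weight M x ^ 2 = M + x ^ 2 :=
  Real.sq_sqrt (by positivity)

theorem one_le_weight (hM : 1 ≤ M) (x : ℝ) : 1 ≤ weight M x :=
  Real.one_le_sqrt.2 (by nlinarith [sq_nonneg x])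

theorem weight_pos (hM : 1 ≤ M) (x : ℝ) : 0 < weight M x :=
  one_pos.trans_le (one_le_weight hM x)

theorem abs_le_weight (hM : 1 ≤ M) (x : ℝ) : |x| ≤ weight M x :=
  Real.abs_le_sqrt (by linarith)

theorem hasDerivAt_weight (hM : 1 ≤ M) (x : ℝ) :
    HasDerivAt (weight M) (x / weight M x) x := by
  have h : HasDerivAt (fun y : ℝ => M + y ^ 2) (2 * x) x := by
    simpa using (hasDerivAt_pow 2 x).const_add M
  have := h.sqrt (by positivity)
  rwa [mul_div_mul_left _ _ two_ne_zero] at this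

theorem continuous_weight (M : ℝ) : Continuous (weight M) := by
  unfold weight
  fun_prop

theorem hasDerivAt_weight_rpow (hM : 1 ≤ M) (γ x : ℝ) :
    HasDerivAt (fun y => weight M y ^ γ) (γ * x * weight M x ^ (γ - 2)) x := by
  have hw := weight_pos hM x
  convert (hasDerivAt_weight hM x).rpow_const (p := γ) (Or.inl hw.ne') using 1
  rw [show γ - 1 = (γ - 2) + 1 by ring, Real.rpow_add_one hw.ne']
  field_simp

theorem integrable_weight_rpow (hM : 1 ≤ M) {s : ℝ} (hs : 1 < s) :
    Integrable fun x => weight M x ^ (-s) := by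
  have h := integrable_rpow_neg_one_add_norm_sq (E := ℝ) (μ := volume) (r := s) (by simpa using hs)
  refine h.mono' ?_ (Eventually.of_forall fun x => ?_)
  · exact ((continuous_weight M).rpow_const
      fun x => Or.inl (weight_pos hM x).ne').aestronglyMeasurable
  · rw [Real.norm_of_nonneg (Real.rpow_nonneg (weight_pos hM x).le _), Real.norm_eq_abs, sq_abs,
      weight, Real.sqrt_eq_rpow, ← Real.rpow_mul (by positivity)]
    rw [show 1 / 2 * -s = -s / 2 by ring]
    exact Real.rpow_le_rpow_of_nonpos (by positivity) (by linarith) (by linarith)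

end Weight

/-- Symbols of order `γ`: differentiable functions of size `O(|x|^γ)` whose derivative is of size
`O(|x|^(γ-1))`. -/
def IsSymbol (M γ : ℝ) (f : ℝ → ℝ) : Prop :=
  ∃ K, ∀ x, DifferentiableAt ℝ f x ∧ |f x| ≤ K * weight M x ^ γ ∧
    |deriv f x| ≤ K * weight M x ^ (γ - 1)

namespace IsSymbol

variable {M γ γ' : ℝ} {f g : ℝ → ℝ}

theorem add (hf : IsSymbol M γ f) (hg : IsSymbol M γ g) :
    IsSymbol M γ fun x => f x + g x := by
  obtain ⟨K, hK⟩ := hf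
  obtain ⟨L, hL⟩ := hg
  refine ⟨K + L, fun x => ⟨(hK x).1.add (hL x).1, ?_, ?_⟩⟩
  · rw [add_mul]
    exact (abs_add_le _ _).trans (add_le_add (hK x).2.1 (hL x).2.1)
  · rw [deriv_fun_add (hK x).1 (hL x).1, add_mul]
    exact (abs_add_le _ _).trans (add_le_add (hK x).2.2 (hL x).2.2)

theorem mul (hM : 1 ≤ M) (hf : IsSymbol M γ f) (hg : IsSymbol M γ' g) :
    IsSymbol M (γ + γ') fun x => f x * g x := by
  obtain ⟨K, hK⟩ := hf
  obtain ⟨L, hL⟩ := hg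
  refine ⟨2 * |K * L|, fun x => ⟨(hK x).1.mul (hL x).1, ?_, ?_⟩⟩
  all_goals have hw := weight_pos hM x
  all_goals have hKL := le_abs_self (K * L)
  · have h := mul_le_mul (hK x).2.1 (hL x).2.1 (abs_nonneg _) ((abs_nonneg _).trans (hK x).2.1)
    have hpos := Real.rpow_pos_of_pos hw (γ + γ')
    rw [mul_mul_mul_comm, ← Real.rpow_add hw, ← abs_mul] at h
    nlinarith [abs_nonneg (K * L)]
  · have h₁ := mul_le_mul (hK x).2.2 (hL x).2.1 (abs_nonneg _) ((abs_nonneg _).trans (hK x).2.2)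
    have h₂ := mul_le_mul (hK x).2.1 (hL x).2.2 (abs_nonneg _) ((abs_nonneg _).trans (hK x).2.1)
    have hpos := Real.rpow_pos_of_pos hw (γ + γ' - 1)
    rw [mul_mul_mul_comm, ← Real.rpow_add hw, ← abs_mul] at h₁ h₂
    rw [show γ - 1 + γ' = γ + γ' - 1 by ring] at h₁
    rw [show γ + (γ' - 1) = γ + γ' - 1 by ring] at h₂
    rw [deriv_fun_mul (hK x).1 (hL x).1]
    refine (abs_add_le _ _).trans ?_
    nlinarith [abs_nonneg (K * L)]

theorem const_mul (c : ℝ) (hf : IsSymbol M γ f) : IsSymbol M γ fun x => c * f x := by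
  obtain ⟨K, hK⟩ := hf
  refine ⟨|c| * K, fun x => ⟨(hK x).1.const_mul c, ?_, ?_⟩⟩
  · rw [abs_mul, mul_assoc]
    exact mul_le_mul_of_nonneg_left (hK x).2.1 (abs_nonneg c)
  · rw [deriv_const_mul_field', abs_mul, mul_assoc]
    exact mul_le_mul_of_nonneg_left (hK x).2.2 (abs_nonneg c)

theorem sub (hf : IsSymbol M γ f) (hg : IsSymbol M γ g) :
    IsSymbol M γ fun x => f x - g x := by
  simpa [sub_eq_add_neg] using hf.add (hg.const_mul (-1))

theorem mono_order (hM : 1 ≤ M) (hf : IsSymbol M γ f) (h : γ ≤ γ') : IsSymbol M γ' f := by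
  obtain ⟨K, hK⟩ := hf
  refine ⟨|K|, fun x => ⟨(hK x).1, (hK x).2.1.trans ?_, (hK x).2.2.trans ?_⟩⟩
  all_goals
    refine mul_le_mul (le_abs_self K) ?_ (Real.rpow_nonneg (weight_pos hM x).le _) (abs_nonneg K)
    exact Real.rpow_le_rpow_of_exponent_le (one_le_weight hM x) (by linarith)

theorem weight_rpow (hM : 1 ≤ M) (γ : ℝ) : IsSymbol M γ fun x => weight M x ^ γ := by
  refine ⟨1 + |γ|, fun x => ⟨(hasDerivAt_weight_rpow hM γ x).differentiableAt, ?_, ?_⟩⟩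
  all_goals have hw := weight_pos hM x
  · have := Real.rpow_pos_of_pos hw γ
    rw [abs_of_pos this]
    nlinarith [abs_nonneg γ]
  · have hpos := Real.rpow_pos_of_pos hw (γ - 2)
    rw [(hasDerivAt_weight_rpow hM γ x).deriv, abs_mul, abs_mul, abs_of_pos hpos,
      show γ - 1 = γ - 2 + 1 by ring, Real.rpow_add_one hw.ne', mul_comm (weight M x ^ (γ - 2)),
      ← mul_assoc]
    gcongr
    · linarith
    · exact abs_le_weight hM x

protected theorem id (hM : 1 ≤ M) : IsSymbol M 1 fun x => x :=
  ⟨1, fun x => ⟨differentiableAt_id, by simpa using abs_le_weight hM x, by simp⟩⟩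

end IsSymbol

/-- `f` is, up to an error of size `O(|x|^(-1-δ))`, the derivative of a bounded function. -/
def HasBoundedPrimitive (M δ : ℝ) (f : ℝ → ℝ) : Prop :=
  ∃ (F : ℝ → ℝ) (K : ℝ), ∀ x, DifferentiableAt ℝ F x ∧ |F x| ≤ K ∧
    |deriv F x - f x| ≤ K * weight M x ^ (-1 - δ)

namespace HasBoundedPrimitive

variable {M δ : ℝ} {f g : ℝ → ℝ}

theorem add (hf : HasBoundedPrimitive M δ f) (hg : HasBoundedPrimitive M δ g) :
    HasBoundedPrimitive M δ fun x => f x + g x := by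
  obtain ⟨F, K, hF⟩ := hf
  obtain ⟨G, L, hG⟩ := hg
  refine ⟨fun x => F x + G x, K + L, fun x => ⟨(hF x).1.add (hG x).1, ?_, ?_⟩⟩
  · exact (abs_add_le _ _).trans (add_le_add (hF x).2.1 (hG x).2.1)
  · rw [deriv_fun_add (hF x).1 (hG x).1, add_mul, add_sub_add_comm]
    exact (abs_add_le _ _).trans (add_le_add (hF x).2.2 (hG x).2.2)

theorem const_mul (c : ℝ) (hf : HasBoundedPrimitive M δ f) :
    HasBoundedPrimitive M δ fun x => c * f x := by
  obtain ⟨F, K, hF⟩ := hf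
  refine ⟨fun x => c * F x, |c| * K, fun x => ⟨(hF x).1.const_mul c, ?_, ?_⟩⟩
  · rw [abs_mul]
    exact mul_le_mul_of_nonneg_left (hF x).2.1 (abs_nonneg c)
  · rw [deriv_const_mul_field', ← mul_sub, abs_mul, mul_assoc]
    exact mul_le_mul_of_nonneg_left (hF x).2.2 (abs_nonneg c)

theorem zero : HasBoundedPrimitive M δ fun _ => 0 :=
  ⟨fun _ => 0, 0, fun x => by simp⟩

theorem sum {ι : Type*} {f : ι → ℝ → ℝ} (s : Finset ι)
    (hf : ∀ i ∈ s, HasBoundedPrimitive M δ (f i)) :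
    HasBoundedPrimitive M δ fun x => ∑ i ∈ s, f i x := by
  classical
  induction s using Finset.induction_on with
  | empty => simpa using zero
  | insert i s hi ih =>
    simp only [Finset.sum_insert hi]
    exact (hf i (by simp)).add (ih fun k hk => hf k (by simp [hk]))

/-- Integration by parts against an oscillating factor of frequency `ω`. -/
theorem of_oscillating (hM : 1 ≤ M) (hδ : 0 ≤ δ) {A ψ ω : ℝ → ℝ} (hA : IsSymbol M (-δ) A)
    (hψ : ∃ K, ∀ x, DifferentiableAt ℝ ψ x ∧ |deriv ψ x - ω x| ≤ K / weight M x) :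
    HasBoundedPrimitive M δ fun x => A x * ω x * Real.cos (ψ x) := by
  obtain ⟨K, hK⟩ := hA
  obtain ⟨L, hL⟩ := hψ
  have hK0 : 0 ≤ K := by
    have h := (abs_nonneg _).trans (hK 0).2.1
    exact nonneg_of_mul_nonneg_left h (Real.rpow_pos_of_pos (weight_pos hM 0) _)
  have hL0 : 0 ≤ L := by
    have h := (abs_nonneg _).trans (hL 0).2
    rw [div_eq_mul_inv] at h
    exact nonneg_of_mul_nonneg_left h (inv_pos.2 (weight_pos hM 0))
  refine ⟨fun x => A x * Real.sin (ψ x), K + K * L, fun x =>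
    ⟨(hK x).1.mul (hL x).1.sin, ?_, ?_⟩⟩
  · rw [abs_mul]
    have h₁ : weight M x ^ (-δ) ≤ 1 :=
      Real.rpow_le_one_of_one_le_of_nonpos (one_le_weight hM x) (by linarith)
    have h₂ := (hK x).2.1
    have h₃ := Real.abs_sin_le_one (ψ x)
    nlinarith [abs_nonneg (A x), mul_nonneg hK0 hL0]
  · have hw := weight_pos hM x
    rw [deriv_fun_mul (hK x).1 (hL x).1.sin, deriv_sin (hL x).1]
    rw [show deriv A x * Real.sin (ψ x) + A x * (Real.cos (ψ x) * deriv ψ x) -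
      A x * ω x * Real.cos (ψ x) = deriv A x * Real.sin (ψ x) +
        A x * (deriv ψ x - ω x) * Real.cos (ψ x) by ring, add_mul]
    refine (abs_add_le _ _).trans (add_le_add ?_ ?_)
    · rw [abs_mul, show -1 - δ = -δ - 1 by ring]
      exact (mul_le_of_le_one_right (abs_nonneg _) (Real.abs_sin_le_one _)).trans (hK x).2.2
    · rw [abs_mul, abs_mul, show -1 - δ = -δ - 1 by ring, Real.rpow_sub_one hw.ne']
      refine (mul_le_of_le_one_right (by positivity) (Real.abs_cos_le_one _)).trans ?_
      refine (mul_le_mul (hK x).2.1 (hL x).2 (abs_nonneg _)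
        ((abs_nonneg _).trans (hK x).2.1)).trans (le_of_eq ?_)
      ring

/-- A function whose derivative is dominated by an `f` with bounded primitive is bounded above on
the half-line. -/
theorem exists_le (hM : 1 ≤ M) (hδ : 0 < δ) (hf : HasBoundedPrimitive M δ f) {G : ℝ → ℝ}
    (hG : ∀ x, 0 ≤ x → DifferentiableAt ℝ G x ∧ deriv G x ≤ f x) :
    ∃ B, ∀ x, 0 ≤ x → G x ≤ B := by
  obtain ⟨F, K, hF⟩ := hf
  have hint : Integrable fun x => weight M x ^ (-1 - δ) := by
    have := integrable_weight_rpow hM (s := 1 + δ) (by linarith)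
    rwa [neg_add'] at this
  have hcont : Continuous fun x => weight M x ^ (-1 - δ) :=
    (continuous_weight M).rpow_const fun x => Or.inl (weight_pos hM x).ne'
  set H : ℝ → ℝ := fun x => ∫ t in (0 : ℝ)..x, weight M t ^ (-1 - δ) with hH
  have hHd : ∀ x, HasDerivAt H (weight M x ^ (-1 - δ)) x := fun x =>
    (hcont.integral_hasStrictDerivAt 0 x).hasDerivAt
  have hHb : ∀ x, 0 ≤ x → H x ≤ ∫ t, weight M t ^ (-1 - δ) := fun x hx => by
    rw [hH]
    simp only
    rw [intervalIntegral.integral_of_le hx]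
    exact setIntegral_le_integral hint
      (Eventually.of_forall fun t => Real.rpow_nonneg (weight_pos hM t).le _)
  have hK0 : 0 ≤ K := (abs_nonneg _).trans (hF 0).2.1
  have hanti : AntitoneOn (fun x => G x - F x - K * H x) (Ici 0) := by
    have hd : ∀ x, 0 ≤ x → HasDerivAt (fun x => G x - F x - K * H x)
        (deriv G x - deriv F x - K * weight M x ^ (-1 - δ)) x := fun x hx =>
      ((hG x hx).1.hasDerivAt.sub (hF x).1.hasDerivAt).sub ((hHd x).const_mul K)
    refine antitoneOn_of_deriv_nonpos (convex_Ici 0)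
      (fun x hx => (hd x hx).continuousAt.continuousWithinAt)
      (fun x hx => (hd x (interior_subset hx)).differentiableAt.differentiableWithinAt)
      fun x hx => ?_
    have hx0 : 0 ≤ x := interior_subset (s := Ici (0 : ℝ)) hx
    rw [(hd x hx0).deriv]
    have h₁ := (abs_le.1 (hF x).2.2).1
    linarith [(hG x hx0).2]
  refine ⟨G 0 - F 0 - K * H 0 + K + K * ∫ t, weight M t ^ (-1 - δ), fun x hx => ?_⟩
  have h := hanti (mem_Ici.2 le_rfl) (mem_Ici.2 hx) hx
  simp only at h
  have h₂ := (abs_le.1 (hF x).2.1).2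
  have h₃ := mul_le_mul_of_nonneg_left (hHb x hx) hK0
  linarith

end HasBoundedPrimitive

/-- The local momentum `√(w^α + e)` of a particle of energy `e`, where `w` is the weight. -/
noncomputable def momentum (M α e x : ℝ) : ℝ := √(weight M x ^ α + e)

/-- Half of the logarithmic derivative of the momentum. -/
noncomputable def momentumRate (M α e x : ℝ) : ℝ :=
  α * x * weight M x ^ (α - 2) / (4 * momentum M α e x ^ 2)

section Momentum

variable {M α e e' : ℝ}

theorem two_mul_abs_le_weight_rpow (hM : 1 ≤ M) (hα : 0 < α) (he : 2 * |e| ≤ M ^ (α / 2))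
    (x : ℝ) : 2 * |e| ≤ weight M x ^ α := by
  refine he.trans ?_
  rw [weight, Real.sqrt_eq_rpow, ← Real.rpow_mul (by positivity), show 1 / 2 * α = α / 2 by ring]
  exact Real.rpow_le_rpow (by positivity) (by nlinarith [sq_nonneg x]) (by positivity)

theorem weight_rpow_add_pos (hM : 1 ≤ M) (hα : 0 < α) (he : 2 * |e| ≤ M ^ (α / 2)) (x : ℝ) :
    0 < weight M x ^ α + e := by
  have h₁ := two_mul_abs_le_weight_rpow hM hα he x
  have h₂ := Real.rpow_pos_of_pos (weight_pos hM x) α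
  have h₃ := neg_abs_le e
  linarith

theorem momentum_pos (hM : 1 ≤ M) (hα : 0 < α) (he : 2 * |e| ≤ M ^ (α / 2)) (x : ℝ) :
    0 < momentum M α e x :=
  Real.sqrt_pos.2 (weight_rpow_add_pos hM hα he x)

theorem sq_momentum (hM : 1 ≤ M) (hα : 0 < α) (he : 2 * |e| ≤ M ^ (α / 2)) (x : ℝ) :
    momentum M α e x ^ 2 = weight M x ^ α + e :=
  Real.sq_sqrt (weight_rpow_add_pos hM hα he x).le

theorem sq_weight_rpow_half (hM : 1 ≤ M) (α x : ℝ) :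
    (weight M x ^ (α / 2)) ^ 2 = weight M x ^ α := by
  rw [← Real.rpow_natCast, ← Real.rpow_mul (weight_pos hM x).le]
  norm_num

theorem momentum_le (hM : 1 ≤ M) (hα : 0 < α) (he : 2 * |e| ≤ M ^ (α / 2)) (x : ℝ) :
    momentum M α e x ≤ 2 * weight M x ^ (α / 2) := by
  refine abs_le_of_sq_le_sq' ?_ (by positivity [weight_pos hM x]) |>.2
  rw [sq_momentum hM hα he, mul_pow, sq_weight_rpow_half hM]
  have h₁ := two_mul_abs_le_weight_rpow hM hα he x
  have h₂ := le_abs_self e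
  have h₃ := abs_nonneg e
  linarith

theorem weight_rpow_half_le (hM : 1 ≤ M) (hα : 0 < α) (he : 2 * |e| ≤ M ^ (α / 2)) (x : ℝ) :
    weight M x ^ (α / 2) ≤ 2 * momentum M α e x := by
  refine abs_le_of_sq_le_sq' ?_ (by positivity [momentum_pos hM hα he x]) |>.2
  rw [sq_weight_rpow_half hM, mul_pow, sq_momentum hM hα he]
  have h₁ := two_mul_abs_le_weight_rpow hM hα he x
  have h₂ := neg_abs_le e
  have h₃ := abs_nonneg e
  linarith

theorem inv_momentum_le (hM : 1 ≤ M) (hα : 0 < α) (he : 2 * |e| ≤ M ^ (α / 2)) (x : ℝ) :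
    (momentum M α e x)⁻¹ ≤ 2 * weight M x ^ (-(α / 2)) := by
  rw [Real.rpow_neg (weight_pos hM x).le, ← div_eq_mul_inv,
    inv_le_comm₀ (momentum_pos hM hα he x) (by positivity [weight_pos hM x]), inv_div]
  linarith [weight_rpow_half_le hM hα he x]

theorem momentum_div_momentum_le (hM : 1 ≤ M) (hα : 0 < α) (he : 2 * |e| ≤ M ^ (α / 2))
    (he' : 2 * |e'| ≤ M ^ (α / 2)) (x : ℝ) : momentum M α e x / momentum M α e' x ≤ 4 := by
  rw [div_le_iff₀ (momentum_pos hM hα he' x)]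
  linarith [momentum_le hM hα he x, weight_rpow_half_le hM hα he' x]

theorem hasDerivAt_momentum (hM : 1 ≤ M) (hα : 0 < α) (he : 2 * |e| ≤ M ^ (α / 2)) (x : ℝ) :
    HasDerivAt (momentum M α e) (2 * momentumRate M α e x * momentum M α e x) x := by
  have hp := momentum_pos hM hα he x
  have h := ((hasDerivAt_weight_rpow hM α x).add_const e).sqrt
    (weight_rpow_add_pos hM hα he x).ne'
  refine h.congr_deriv ?_
  change _ / (2 * momentum M α e x) = _
  rw [momentumRate]
  field_simp
  ring

theorem abs_momentumRate_le (hM : 1 ≤ M) (hα : 0 < α) (he : 2 * |e| ≤ M ^ (α / 2)) (x : ℝ) :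
    |momentumRate M α e x| ≤ α / weight M x := by
  have hw := weight_pos hM x
  have hp := momentum_pos hM hα he x
  have hwα := Real.rpow_pos_of_pos hw (α - 2)
  rw [momentumRate, abs_div, abs_mul, abs_mul, abs_of_pos hα, abs_of_pos hwα,
    abs_of_pos (by positivity : 0 < 4 * momentum M α e x ^ 2), div_le_div_iff₀ (by positivity) hw]
  have h₁ : weight M x ^ (α - 2) * weight M x ^ 2 = weight M x ^ α := by
    rw [← Real.rpow_natCast, ← Real.rpow_add hw]
    norm_num
  have h₂ : weight M x ^ α ≤ 4 * momentum M α e x ^ 2 := by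
    have := pow_le_pow_left₀ (by positivity) (weight_rpow_half_le hM hα he x) 2
    rw [sq_weight_rpow_half hM, mul_pow] at this
    linarith
  calc α * |x| * weight M x ^ (α - 2) * weight M x
      ≤ α * weight M x * weight M x ^ (α - 2) * weight M x := by
        gcongr
        exact abs_le_weight hM x
    _ = α * weight M x ^ α := by rw [← h₁]; ring
    _ ≤ α * (4 * momentum M α e x ^ 2) := by gcongr

theorem continuous_momentum (hM : 1 ≤ M) (hα : 0 < α) (he : 2 * |e| ≤ M ^ (α / 2)) :
    Continuous (momentum M α e) :=
  continuous_iff_continuousAt.2 fun x => (hasDerivAt_momentum hM hα he x).continuousAt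

theorem continuous_momentumRate (hM : 1 ≤ M) (hα : 0 < α) (he : 2 * |e| ≤ M ^ (α / 2)) :
    Continuous (momentumRate M α e) := by
  refine Continuous.div ((continuous_const.mul continuous_id).mul ?_)
    (continuous_const.mul ((continuous_momentum hM hα he).pow 2))
    fun x => by positivity [momentum_pos hM hα he x]
  exact (continuous_weight M).rpow_const fun x => Or.inl (weight_pos hM x).ne'

theorem isSymbol_momentum (hM : 1 ≤ M) (hα : 0 < α) (he : 2 * |e| ≤ M ^ (α / 2)) :
    IsSymbol M (α / 2) (momentum M α e) := by
  refine ⟨2 + 4 * α, fun x => ⟨(hasDerivAt_momentum hM hα he x).differentiableAt, ?_, ?_⟩⟩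
  all_goals
    have hw := weight_pos hM x
    have hp := momentum_pos hM hα he x
    have h := momentum_le hM hα he x
    have hwα := Real.rpow_pos_of_pos hw (α / 2)
  · rw [abs_of_pos hp]
    nlinarith
  · rw [(hasDerivAt_momentum hM hα he x).deriv, abs_mul, abs_mul, abs_two, abs_of_pos hp,
      Real.rpow_sub_one hw.ne']
    calc 2 * |momentumRate M α e x| * momentum M α e x
        ≤ 2 * (α / weight M x) * (2 * weight M x ^ (α / 2)) := by
          gcongr
          exact abs_momentumRate_le hM hα he x
      _ = 4 * α * (weight M x ^ (α / 2) / weight M x) := by ring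
      _ ≤ (2 + 4 * α) * (weight M x ^ (α / 2) / weight M x) := by gcongr; linarith

theorem isSymbol_inv_momentum (hM : 1 ≤ M) (hα : 0 < α) (he : 2 * |e| ≤ M ^ (α / 2)) :
    IsSymbol M (-(α / 2)) fun x => (momentum M α e x)⁻¹ := by
  have hd := fun x => (hasDerivAt_momentum hM hα he x).fun_inv (momentum_pos hM hα he x).ne'
  refine ⟨2 + 4 * α, fun x => ⟨(hd x).differentiableAt, ?_, ?_⟩⟩
  all_goals
    have hw := weight_pos hM x
    have hp := momentum_pos hM hα he x
    have h := inv_momentum_le hM hα he x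
    have hwα := Real.rpow_pos_of_pos hw (-(α / 2))
  · rw [abs_of_pos (inv_pos.2 hp)]
    nlinarith
  · rw [(hd x).deriv, show -(2 * momentumRate M α e x * momentum M α e x) / momentum M α e x ^ 2 =
      -(2 * momentumRate M α e x * (momentum M α e x)⁻¹) by field_simp, abs_neg, abs_mul, abs_mul,
      abs_two, abs_of_pos (inv_pos.2 hp), Real.rpow_sub_one hw.ne']
    calc 2 * |momentumRate M α e x| * (momentum M α e x)⁻¹
        ≤ 2 * (α / weight M x) * (2 * weight M x ^ (-(α / 2))) := by
          gcongr
          exact abs_momentumRate_le hM hα he x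
      _ = 4 * α * (weight M x ^ (-(α / 2)) / weight M x) := by ring
      _ ≤ (2 + 4 * α) * (weight M x ^ (-(α / 2)) / weight M x) := by gcongr; linarith

end Momentum

/-- `ψ` oscillates with frequency `ω`, up to an error of size `O(1/|x|)`. -/
def HasFrequency (M : ℝ) (ψ ω : ℝ → ℝ) : Prop :=
  ∃ K, ∀ x, DifferentiableAt ℝ ψ x ∧ |deriv ψ x - ω x| ≤ K / weight M x

namespace HasFrequency

variable {M : ℝ} {ψ ω ψ' ω' : ℝ → ℝ}

theorem add (h : HasFrequency M ψ ω) (h' : HasFrequency M ψ' ω') :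
    HasFrequency M (fun x => ψ x + ψ' x) fun x => ω x + ω' x := by
  obtain ⟨K, hK⟩ := h
  obtain ⟨L, hL⟩ := h'
  refine ⟨K + L, fun x => ⟨(hK x).1.add (hL x).1, ?_⟩⟩
  rw [deriv_fun_add (hK x).1 (hL x).1, add_sub_add_comm, add_div]
  exact (abs_add_le _ _).trans (add_le_add (hK x).2 (hL x).2)

theorem const_mul (c : ℝ) (h : HasFrequency M ψ ω) :
    HasFrequency M (fun x => c * ψ x) fun x => c * ω x := by
  obtain ⟨K, hK⟩ := h
  refine ⟨|c| * K, fun x => ⟨(hK x).1.const_mul c, ?_⟩⟩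
  rw [deriv_const_mul_field', ← mul_sub, abs_mul, mul_div_assoc]
  exact mul_le_mul_of_nonneg_left (hK x).2 (abs_nonneg c)

theorem sub (h : HasFrequency M ψ ω) (h' : HasFrequency M ψ' ω') :
    HasFrequency M (fun x => ψ x - ψ' x) fun x => ω x - ω' x := by
  simpa [sub_eq_add_neg] using h.add (h'.const_mul (-1))

end HasFrequency

section Pruefer

variable {N : ℕ}

/-- The Wigner–von Neumann type potential in resonance with all the phases `y k`. -/
noncomputable def resonantPotential (M α C : ℝ) (E : Fin N → ℝ) (x : ℝ) (y : Fin N → ℝ) : ℝ :=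
  ∑ k, C / weight M x * momentum M α (E k) x * Real.sin (2 * y k)

/-- The vector field governing the Prüfer angles. -/
noncomputable def prueferField (M α C : ℝ) (E : Fin N → ℝ) (x : ℝ) (y : Fin N → ℝ) :
    Fin N → ℝ := fun j =>
  momentum M α (E j) x +
    resonantPotential M α C E x y / momentum M α (E j) x * Real.sin (y j) ^ 2 +
    momentumRate M α (E j) x * Real.sin (2 * y j)

/-- The derivative of the logarithm of the Prüfer radius. -/
noncomputable def radialRate (M α C : ℝ) (E : Fin N → ℝ) (j : Fin N) (x : ℝ) (y : Fin N → ℝ) : ℝ :=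
  -(momentumRate M α (E j) x * Real.cos (2 * y j)) -
    resonantPotential M α C E x y / (2 * momentum M α (E j) x) * Real.sin (2 * y j)

variable {M α C : ℝ} {E : Fin N → ℝ}

theorem resonantPotential_div (x p : ℝ) (y : Fin N → ℝ) :
    resonantPotential M α C E x y / p =
      ∑ k, C / weight M x * (momentum M α (E k) x / p) * Real.sin (2 * y k) := by
  rw [resonantPotential, Finset.sum_div]
  exact Finset.sum_congr rfl fun k _ => by ring

theorem abs_resonantPotential_div_le (hM : 1 ≤ M) (hα : 0 < α) (hC : 0 ≤ C)
    (hE : ∀ k, 2 * |E k| ≤ M ^ (α / 2)) (j : Fin N) (x : ℝ) (y : Fin N → ℝ) :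
    |resonantPotential M α C E x y / momentum M α (E j) x| ≤ 4 * C * N / weight M x := by
  have hw := weight_pos hM x
  rw [resonantPotential_div]
  refine (Finset.abs_sum_le_sum_abs _ _).trans ((Finset.sum_le_card_nsmul _ _ (C / weight M x * 4)
    fun k _ => ?_).trans (le_of_eq ?_))
  · have hk := momentum_pos hM hα (hE k) x
    have hj := momentum_pos hM hα (hE j) x
    rw [abs_mul, abs_of_nonneg (by positivity)]
    refine (mul_le_of_le_one_right (by positivity) (Real.abs_sin_le_one _)).trans ?_
    gcongr
    exact momentum_div_momentum_le hM hα (hE k) (hE j) x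
  · simp only [Finset.card_univ, Fintype.card_fin, nsmul_eq_mul]
    ring

theorem abs_sin_sub_sin_le (a b : ℝ) : |Real.sin a - Real.sin b| ≤ |a - b| := by
  have h := Real.lipschitzWith_sin.dist_le_mul a b
  simpa [Real.dist_eq] using h

theorem abs_sin_mul_sq_sub_le (a b a' b' : ℝ) :
    |Real.sin (2 * a) * Real.sin b ^ 2 - Real.sin (2 * a') * Real.sin b' ^ 2| ≤
      2 * |a - a'| + 2 * |b - b'| := by
  have h₁ : |Real.sin (2 * a) - Real.sin (2 * a')| ≤ 2 * |a - a'| := by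
    refine (abs_sin_sub_sin_le _ _).trans (le_of_eq ?_)
    rw [← mul_sub, abs_mul, abs_two]
  have h₂ := abs_sin_sub_sin_le b b'
  have h₃ : |Real.sin b + Real.sin b'| ≤ 2 :=
    (abs_add_le _ _).trans (by linarith [Real.abs_sin_le_one b, Real.abs_sin_le_one b'])
  rw [show Real.sin (2 * a) * Real.sin b ^ 2 - Real.sin (2 * a') * Real.sin b' ^ 2 =
    (Real.sin (2 * a) - Real.sin (2 * a')) * Real.sin b ^ 2 +
      Real.sin (2 * a') * ((Real.sin b + Real.sin b') * (Real.sin b - Real.sin b')) by ring]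
  refine (abs_add_le _ _).trans (add_le_add ?_ ?_)
  · rw [abs_mul, abs_of_nonneg (sq_nonneg (Real.sin b))]
    exact (mul_le_of_le_one_right (abs_nonneg _) (Real.sin_sq_le_one b)).trans h₁
  · rw [abs_mul, abs_mul]
    exact (mul_le_of_le_one_left (by positivity) (Real.abs_sin_le_one _)).trans
      (mul_le_mul h₃ h₂ (abs_nonneg _) zero_le_two)

theorem lipschitzWith_prueferField (hM : 1 ≤ M) (hα : 0 < α) (hC : 0 ≤ C)
    (hE : ∀ k, 2 * |E k| ≤ M ^ (α / 2)) (x : ℝ) :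
    LipschitzWith (Real.toNNReal (16 * C * N + 2 * α)) (prueferField M α C E x) := by
  refine LipschitzWith.of_dist_le_mul fun y z => ?_
  rw [Real.coe_toNNReal _ (by positivity), dist_pi_le_iff (by positivity)]
  intro j
  have hw := weight_pos hM x
  have hw1 := one_le_weight hM x
  have hj := momentum_pos hM hα (hE j) x
  have hd : ∀ k, |y k - z k| ≤ dist y z := fun k => dist_le_pi_dist y z k
  have hsum : |resonantPotential M α C E x y / momentum M α (E j) x * Real.sin (y j) ^ 2 -
      resonantPotential M α C E x z / momentum M α (E j) x * Real.sin (z j) ^ 2| ≤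
        16 * C * N * dist y z := by
    rw [resonantPotential_div, resonantPotential_div, Finset.sum_mul, Finset.sum_mul,
      ← Finset.sum_sub_distrib]
    refine (Finset.abs_sum_le_sum_abs _ _).trans ((Finset.sum_le_card_nsmul _ _
      (C * 4 * (4 * dist y z)) fun k _ => ?_).trans (le_of_eq ?_))
    · have hk := momentum_pos hM hα (hE k) x
      rw [mul_assoc, mul_assoc (C / weight M x * _), ← mul_sub, abs_mul,
        abs_of_nonneg (by positivity)]
      refine mul_le_mul (mul_le_mul (div_le_self hC hw1)
        (momentum_div_momentum_le hM hα (hE k) (hE j) x) (by positivity) hC) ?_ (abs_nonneg _)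
        (by positivity)
      refine (abs_sin_mul_sq_sub_le _ _ _ _).trans ?_
      linarith [hd k, hd j]
    · simp only [Finset.card_univ, Fintype.card_fin, nsmul_eq_mul]
      ring
  have hrate : |momentumRate M α (E j) x * Real.sin (2 * y j) -
      momentumRate M α (E j) x * Real.sin (2 * z j)| ≤ 2 * α * dist y z := by
    rw [← mul_sub, abs_mul]
    have h₁ := (abs_momentumRate_le hM hα (hE j) x).trans (div_le_self hα.le hw1)
    have h₂ := abs_sin_sub_sin_le (2 * y j) (2 * z j)
    rw [← mul_sub, abs_mul, abs_two] at h₂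
    calc _ ≤ α * (2 * dist y z) :=
          mul_le_mul h₁ (h₂.trans (by linarith [hd j])) (abs_nonneg _) hα.le
      _ = 2 * α * dist y z := by ring
  rw [Real.dist_eq, prueferField, prueferField, add_sub_add_comm, add_sub_add_comm, sub_self,
    zero_add, add_mul]
  exact (abs_add_le _ _).trans (add_le_add hsum hrate)

theorem continuous_resonantPotential (hM : 1 ≤ M) (hα : 0 < α)
    (hE : ∀ k, 2 * |E k| ≤ M ^ (α / 2)) {φ : ℝ → Fin N → ℝ} (hφ : Continuous φ) :
    Continuous fun x => resonantPotential M α C E x (φ x) := by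
  unfold resonantPotential
  have h := continuous_weight M
  have h₁ := fun k => continuous_momentum hM hα (hE k)
  have h₂ := fun x => (weight_pos hM x).ne'
  fun_prop (disch := assumption)

theorem continuous_prueferField (hM : 1 ≤ M) (hα : 0 < α)
    (hE : ∀ k, 2 * |E k| ≤ M ^ (α / 2)) (y : Fin N → ℝ) :
    Continuous fun x => prueferField M α C E x y := by
  refine continuous_pi fun j => ?_
  unfold prueferField
  have h₀ := continuous_resonantPotential (C := C) hM hα hE (continuous_const (y := y))
  have h₁ := continuous_momentum hM hα (hE j)
  have h₂ := continuous_momentumRate hM hα (hE j)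
  have h₃ := fun x => (momentum_pos hM hα (hE j) x).ne'
  fun_prop (disch := assumption)

theorem continuous_radialRate (hM : 1 ≤ M) (hα : 0 < α)
    (hE : ∀ k, 2 * |E k| ≤ M ^ (α / 2)) (j : Fin N) {φ : ℝ → Fin N → ℝ} (hφ : Continuous φ) :
    Continuous fun x => radialRate M α C E j x (φ x) := by
  unfold radialRate
  have h₀ := continuous_resonantPotential (C := C) hM hα hE hφ
  have h₁ := continuous_momentum hM hα (hE j)
  have h₂ := continuous_momentumRate hM hα (hE j)
  have h₃ : ∀ x, 2 * momentum M α (E j) x ≠ 0 := fun x =>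
    mul_ne_zero two_ne_zero (momentum_pos hM hα (hE j) x).ne'
  fun_prop (disch := assumption)

theorem abs_prueferField_sub_le (hM : 1 ≤ M) (hα : 0 < α) (hC : 0 ≤ C)
    (hE : ∀ k, 2 * |E k| ≤ M ^ (α / 2)) (x : ℝ) (y : Fin N → ℝ) (j : Fin N) :
    |prueferField M α C E x y j - momentum M α (E j) x| ≤ (4 * C * N + α) / weight M x := by
  rw [prueferField, add_assoc, add_sub_cancel_left, add_div]
  refine (abs_add_le _ _).trans (add_le_add ?_ ?_)
  · rw [abs_mul, abs_of_nonneg (sq_nonneg (Real.sin (y j)))]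
    exact (mul_le_of_le_one_right (abs_nonneg _) (Real.sin_sq_le_one _)).trans
      (abs_resonantPotential_div_le hM hα hC hE j x y)
  · rw [abs_mul]
    exact (mul_le_of_le_one_right (abs_nonneg _) (Real.abs_sin_le_one _)).trans
      (abs_momentumRate_le hM hα (hE j) x)

open scoped NNReal in
theorem exists_bound_prueferField (hM : 1 ≤ M) (hα : 0 < α) (hC : 0 ≤ C)
    (hE : ∀ k, 2 * |E k| ≤ M ^ (α / 2)) (T : ℝ) :
    ∃ L : ℝ≥0, ∀ x ∈ Icc (-T) T, ∀ y, ‖prueferField M α C E x y‖ ≤ L := by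
  have hwT := weight_pos hM T
  refine ⟨Real.toNNReal (2 * weight M T ^ (α / 2) + (4 * C * N + α)), fun x hx y => ?_⟩
  rw [Real.coe_toNNReal _ (by positivity), pi_norm_le_iff_of_nonneg (by positivity)]
  intro j
  have hxT : x ^ 2 ≤ T ^ 2 := sq_le_sq' hx.1 hx.2
  have hwx : weight M x ≤ weight M T := Real.sqrt_le_sqrt (by linarith)
  have h₁ := abs_le.1 ((abs_prueferField_sub_le hM hα hC hE x y j).trans
    (div_le_self (by positivity) (one_le_weight hM x)))
  have h₂ := (momentum_le hM hα (hE j) x).trans (mul_le_mul_of_nonneg_left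
    (Real.rpow_le_rpow (weight_pos hM x).le hwx (by positivity : 0 ≤ α / 2)) zero_le_two)
  have h₃ := momentum_pos hM hα (hE j) x
  rw [Real.norm_eq_abs, abs_le]
  constructor <;> linarith [h₁.1, h₁.2]

theorem exists_pruefer_angles (hM : 1 ≤ M) (hα : 0 < α) (hC : 0 ≤ C)
    (hE : ∀ k, 2 * |E k| ≤ M ^ (α / 2)) (y₀ : Fin N → ℝ) :
    ∃ φ : ℝ → Fin N → ℝ, φ 0 = y₀ ∧
      ∀ x, HasDerivAt φ (prueferField M α C E x (φ x)) x :=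
  exists_global_integralCurve (lipschitzWith_prueferField hM hα hC hE)
    (continuous_prueferField hM hα hE) (exists_bound_prueferField hM hα hC hE) y₀

theorem hasFrequency_pruefer_angle (hM : 1 ≤ M) (hα : 0 < α) (hC : 0 ≤ C)
    (hE : ∀ k, 2 * |E k| ≤ M ^ (α / 2)) {φ : ℝ → Fin N → ℝ}
    (hφ : ∀ x, HasDerivAt φ (prueferField M α C E x (φ x)) x) (j : Fin N) :
    HasFrequency M (fun x => φ x j) (momentum M α (E j)) := by
  refine ⟨4 * C * N + α, fun x => ?_⟩
  have h := hasDerivAt_pi.1 (hφ x) j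
  refine ⟨h.differentiableAt, ?_⟩
  rw [h.deriv]
  exact abs_prueferField_sub_le hM hα hC hE x (φ x) j

/-- The part of the radial rate of the `j`-th solution that oscillates. -/
noncomputable def oscillatingRate (M α C : ℝ) (E : Fin N → ℝ) (j : Fin N) (x : ℝ)
    (y : Fin N → ℝ) : ℝ :=
  -1 * (momentumRate M α (E j) x * Real.cos (2 * y j)) +
    C / (4 * weight M x) * Real.cos (4 * y j) +
    ∑ k, if k = j then 0 else
      C * momentum M α (E k) x / (4 * weight M x * momentum M α (E j) x) *
          Real.cos (2 * (y k + y j)) +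
        -1 * (C * momentum M α (E k) x / (4 * weight M x * momentum M α (E j) x) *
          Real.cos (2 * (y k - y j)))

theorem radialRate_eq (hM : 1 ≤ M) (hα : 0 < α) (hE : ∀ k, 2 * |E k| ≤ M ^ (α / 2))
    (j : Fin N) (x : ℝ) (y : Fin N → ℝ) :
    radialRate M α C E j x y = oscillatingRate M α C E j x y - C / (4 * weight M x) := by
  have hw := (weight_pos hM x).ne'
  have hp := (momentum_pos hM hα (hE j) x).ne'
  have hsum : resonantPotential M α C E x y / (2 * momentum M α (E j) x) * Real.sin (2 * y j) =
      ∑ k, ((if k = j then C / (4 * weight M x) * (1 - Real.cos (4 * y j)) else 0) -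
        if k = j then 0 else
          C * momentum M α (E k) x / (4 * weight M x * momentum M α (E j) x) *
              Real.cos (2 * (y k + y j)) +
            -1 * (C * momentum M α (E k) x / (4 * weight M x * momentum M α (E j) x) *
              Real.cos (2 * (y k - y j)))) := by
    rw [resonantPotential_div, Finset.sum_mul]
    refine Finset.sum_congr rfl fun k _ => ?_
    split_ifs with h
    · subst h
      rw [show 4 * y k = 2 * (2 * y k) by ring, Real.cos_two_mul, Real.cos_sq']
      field_simp
      ring
    · rw [mul_add, mul_sub, Real.cos_add, Real.cos_sub]
      field_simp
      ring
  rw [radialRate, oscillatingRate, hsum, Finset.sum_sub_distrib,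
    Finset.sum_ite_eq' Finset.univ j, if_pos (Finset.mem_univ j)]
  ring

theorem hasBoundedPrimitive_oscillatingRate (hM : 1 ≤ M) (hα : 0 < α) (hα2 : α < 2) (hC : 0 ≤ C)
    (hE : ∀ k, 2 * |E k| ≤ M ^ (α / 2)) (hinj : Function.Injective E) {φ : ℝ → Fin N → ℝ}
    (hφ : ∀ x, HasDerivAt φ (prueferField M α C E x (φ x)) x) (j : Fin N) :
    HasBoundedPrimitive M (1 - α / 2) fun x => oscillatingRate M α C E j x (φ x) := by
  have hδ : 0 ≤ 1 - α / 2 := by linarith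
  have hω := hasFrequency_pruefer_angle hM hα hC hE hφ
  have hp := fun k => isSymbol_momentum hM hα (hE k)
  have hpi := fun k => isSymbol_inv_momentum hM hα (hE k)
  have hp0 := fun k x => (momentum_pos hM hα (hE k) x).ne'
  have hw0 := fun x => (weight_pos hM x).ne'
  have hwi := IsSymbol.weight_rpow hM (-1)
  have hwinv : ∀ x, weight M x ^ (-1 : ℝ) = (weight M x)⁻¹ := fun x => Real.rpow_neg_one _
  refine HasBoundedPrimitive.add (HasBoundedPrimitive.add
    (HasBoundedPrimitive.const_mul _ ?_) ?_) (HasBoundedPrimitive.sum _ fun k _ => ?_)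
  · have hA := (((((IsSymbol.id hM).mul hM (IsSymbol.weight_rpow hM (α - 2))).mul hM (hpi j)).mul
      hM (hpi j)).mul hM (hpi j)).const_mul (α / 8)
    have h := HasBoundedPrimitive.of_oscillating hM hδ (hA.mono_order hM (by linarith))
      ((hω j).const_mul 2)
    convert h using 3 with x
    rw [momentumRate]
    have := hp0 j x
    field_simp
    ring
  · have hA := (hwi.mul hM (hpi j)).const_mul (C / 16)
    have h := HasBoundedPrimitive.of_oscillating hM hδ (hA.mono_order hM (by linarith))
      ((hω j).const_mul 4)
    convert h using 3 with x
    have := hp0 j x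
    have := hw0 x
    rw [hwinv]
    field_simp
    ring
  · by_cases hkj : k = j
    · simpa only [if_pos hkj] using HasBoundedPrimitive.zero
    simp only [if_neg hkj]
    have hne : E k - E j ≠ 0 := sub_ne_zero.2 fun h => hkj (hinj h)
    have hsq : ∀ x, momentum M α (E k) x ^ 2 - momentum M α (E j) x ^ 2 = E k - E j := fun x => by
      rw [sq_momentum hM hα (hE k), sq_momentum hM hα (hE j)]
      ring
    have hbase := ((hwi.mul hM (hp k)).mul hM (hpi j))
    refine HasBoundedPrimitive.add ?_ (HasBoundedPrimitive.const_mul _ ?_)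
    · have hA := (hbase.mul hM ((hp k).sub (hp j))).const_mul (C / (8 * (E k - E j)))
      have h := HasBoundedPrimitive.of_oscillating hM hδ (hA.mono_order hM (by linarith))
        (((hω k).add (hω j)).const_mul 2)
      convert h using 3 with x
      have := hp0 j x
      have := hw0 x
      rw [hwinv]
      field_simp
      rw [← hsq x]
      ring
    · have hA := (hbase.mul hM ((hp k).add (hp j))).const_mul (C / (8 * (E k - E j)))
      have h := HasBoundedPrimitive.of_oscillating hM hδ (hA.mono_order hM (by linarith))
        (((hω k).sub (hω j)).const_mul 2)
      convert h using 3 with x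
      have := hp0 j x
      have := hw0 x
      rw [hwinv]
      field_simp
      rw [← hsq x]
      ring

theorem exists_radius_le (hM : 1 ≤ M) (hα : 0 < α) (hα2 : α < 2) (hC : 0 ≤ C)
    (hE : ∀ k, 2 * |E k| ≤ M ^ (α / 2)) (hinj : Function.Injective E) {φ : ℝ → Fin N → ℝ}
    (hφ : ∀ x, HasDerivAt φ (prueferField M α C E x (φ x)) x) (j : Fin N) {ρ : ℝ → ℝ}
    (hρ : ∀ x, HasDerivAt ρ (radialRate M α C E j x (φ x)) x) :
    ∃ B, ∀ x, 0 ≤ x → Real.exp (ρ x) ≤ B * weight M x ^ (-(C / 4)) := by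
  obtain ⟨B, hB⟩ := HasBoundedPrimitive.exists_le
    (G := fun x => ρ x + C / 4 * Real.log (weight M x))
    hM (by linarith : 0 < 1 - α / 2)
    (hasBoundedPrimitive_oscillatingRate hM hα hα2 hC hE hinj hφ j) fun x _ => by
      have hw := weight_pos hM x
      have hd := (hρ x).add (((hasDerivAt_weight hM x).log hw.ne').const_mul (C / 4))
      refine ⟨hd.differentiableAt, hd.deriv.trans_le ?_⟩
      rw [radialRate_eq hM hα hE]
      have h : x / weight M x / weight M x ≤ 1 / weight M x := by
        gcongr
        exact (div_le_one hw).2 ((le_abs_self x).trans (abs_le_weight hM x))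
      have h' : C / (4 * weight M x) = C / 4 * (1 / weight M x) := by field_simp
      rw [h']
      nlinarith
  refine ⟨Real.exp B, fun x hx => ?_⟩
  have hw := weight_pos hM x
  rw [Real.rpow_def_of_pos hw, ← Real.exp_add, Real.exp_le_exp]
  linarith [hB x hx]

end Pruefer

theorem hasDerivAt_pruefer_solution {φ ρ s : ℝ → ℝ} {p r Q x : ℝ} (hp : 0 < p) (hs : s x ^ 2 = p)
    (hsd : HasDerivAt s (r * s x) x)
    (hφ : HasDerivAt φ (p + Q / p * Real.sin (φ x) ^ 2 + r * Real.sin (2 * φ x)) x)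
    (hρ : HasDerivAt ρ (-(r * Real.cos (2 * φ x)) - Q / (2 * p) * Real.sin (2 * φ x)) x) :
    HasDerivAt (fun y => Real.exp (ρ y) * Real.sin (φ y) / s y)
      (Real.exp (ρ x) * Real.cos (φ x) * s x) x := by
  have hs0 : s x ≠ 0 := fun h => by simp [h] at hs; exact hp.ne hs
  refine ((hρ.exp.mul hφ.sin).div hsd hs0).congr_deriv ?_
  rw [Real.sin_two_mul, Real.cos_two_mul, ← hs]
  simp only [Pi.mul_apply]
  field_simp
  ring

theorem hasDerivAt_deriv_pruefer_solution {φ ρ s : ℝ → ℝ} {p r Q x : ℝ} (hp : 0 < p)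
    (hs : s x ^ 2 = p) (hsd : HasDerivAt s (r * s x) x)
    (hφ : HasDerivAt φ (p + Q / p * Real.sin (φ x) ^ 2 + r * Real.sin (2 * φ x)) x)
    (hρ : HasDerivAt ρ (-(r * Real.cos (2 * φ x)) - Q / (2 * p) * Real.sin (2 * φ x)) x) :
    HasDerivAt (fun y => Real.exp (ρ y) * Real.cos (φ y) * s y)
      (-(p ^ 2 + Q) * (Real.exp (ρ x) * Real.sin (φ x) / s x)) x := by
  have hs0 : s x ≠ 0 := fun h => by simp [h] at hs; exact hp.ne hs
  refine ((hρ.exp.mul hφ.cos).mul hsd).congr_deriv ?_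
  rw [Real.sin_two_mul, Real.cos_two_mul, ← hs]
  simp only [Pi.mul_apply]
  field_simp
  linear_combination
    -(2 * r * s x ^ 2 * Real.cos (φ x) + Q * Real.sin (φ x)) * Real.sin_sq_add_cos_sq (φ x)

/-- If `sin ∘ φ` vanished on the half-line, so would `cos ∘ φ` for these solutions. -/
theorem exists_pruefer_solution_ne_zero {u u' R φ s : ℝ → ℝ}
    (hd : ∀ x ∈ Ici (0 : ℝ), HasDerivAt u (u' x) x)
    (hu : ∀ x, u x = R x * Real.sin (φ x) / s x) (hu' : ∀ x, u' x = R x * Real.cos (φ x) * s x)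
    (hR : ∀ x, 0 < R x) (hs : ∀ x, 0 < s x) : ∃ x ∈ Ici (0 : ℝ), u x ≠ 0 := by
  by_contra! h
  have hzero : u =ᶠ[nhds 1] fun _ => 0 := by
    filter_upwards [Ioi_mem_nhds (zero_lt_one (α := ℝ))] with x hx
    exact h x (mem_Ici.2 (le_of_lt hx))
  have h₁ : u' 1 = 0 :=
    (hd 1 (mem_Ici.2 zero_le_one)).unique ((hasDerivAt_const 1 0).congr_of_eventuallyEq hzero)
  have h₀ := h 1 (mem_Ici.2 zero_le_one)
  have hR1 := (hR 1).ne'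
  have hs1 := (hs 1).ne'
  have hsin : Real.sin (φ 1) = 0 := by simpa [hu, hR1, hs1] using h₀
  have hcos : Real.cos (φ 1) = 0 := by simpa [hu', hR1, hs1] using h₁
  simpa [hsin, hcos] using Real.sin_sq_add_cos_sq (φ 1)

theorem exists_cos_mul_eq_sin_mul (a b : ℝ) :
    ∃ φ : ℝ, Real.cos φ * b = Real.sin φ * a := by
  set z : ℂ := ⟨a, b⟩ with hz
  refine ⟨z.arg, ?_⟩
  have h₁ : ‖z‖ * Real.cos z.arg = a := Complex.norm_mul_cos_arg z
  have h₂ : ‖z‖ * Real.sin z.arg = b := Complex.norm_mul_sin_arg z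
  rw [← h₁, ← h₂]
  ring

theorem exists_weight_parameter {N : ℕ} {α : ℝ} (hα : 0 < α) (E : Fin N → ℝ) :
    ∃ M : ℝ, 1 ≤ M ∧ ∀ k, 2 * |E k| ≤ M ^ (α / 2) := by
  have hS : 0 ≤ ∑ k, 2 * |E k| := Finset.sum_nonneg fun k _ => by positivity
  refine ⟨(1 + ∑ k, 2 * |E k|) ^ (2 / α),
    Real.one_le_rpow (by linarith) (by positivity), fun k => ?_⟩
  rw [← Real.rpow_mul (by linarith), show 2 / α * (α / 2) = 1 by field_simp, Real.rpow_one]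
  have := Finset.single_le_sum (f := fun k => 2 * |E k|) (fun k _ => by positivity)
    (Finset.mem_univ k)
  linarith

section Asymptotics

variable {M α e : ℝ}

theorem weight_rpow_sub_rpow_nonneg (hM : 1 ≤ M) (hα : 0 < α) {x : ℝ} (hx : 0 < x) :
    0 ≤ weight M x ^ α - x ^ α :=
  sub_nonneg.2 (Real.rpow_le_rpow hx.le ((le_abs_self x).trans (abs_le_weight hM x)) hα.le)

theorem weight_rpow_sub_rpow_le (hM : 1 ≤ M) (hα2 : α < 2) {x : ℝ} (hx : 0 < x) :
    weight M x ^ α - x ^ α ≤ M * weight M x ^ (α - 2) := by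
  have hw := weight_pos hM x
  have hxw : x / weight M x ≤ 1 :=
    (div_le_one hw).2 ((le_abs_self x).trans (abs_le_weight hM x))
  have h := Real.rpow_le_rpow_of_exponent_ge (div_pos hx hw) hxw hα2.le
  rw [Real.div_rpow hx.le hw.le, Real.div_rpow hx.le hw.le, Real.rpow_two, Real.rpow_two,
    div_le_div_iff₀ (by positivity) (by positivity)] at h
  rw [Real.rpow_sub hw, Real.rpow_two, ← mul_div_assoc, le_div_iff₀ (by positivity)]
  linear_combination h + weight M x ^ α * sq_weight hM x

theorem momentum_le_rpow (hM : 1 ≤ M) (hα : 0 < α) (he : 2 * |e| ≤ M ^ (α / 2)) {x : ℝ}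
    (hx : 0 < x) :
    momentum M α e x ≤ weight M x ^ (α / 2) * (1 + |e| * x ^ (-α)) := by
  have hw := weight_pos hM x
  refine abs_le_of_sq_le_sq' ?_ (by positivity) |>.2
  rw [sq_momentum hM hα he, mul_pow, sq_weight_rpow_half hM]
  have h₁ : x ^ α ≤ weight M x ^ α :=
    Real.rpow_le_rpow hx.le ((le_abs_self x).trans (abs_le_weight hM x)) hα.le
  have h₂ : 1 ≤ weight M x ^ α * x ^ (-α) := by
    rw [Real.rpow_neg hx.le, ← div_eq_mul_inv]
    exact (one_le_div (by positivity)).2 h₁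
  have h₃ : 0 ≤ weight M x ^ α * (|e| * x ^ (-α)) ^ 2 := by positivity
  nlinarith [le_abs_self e, abs_nonneg e, mul_le_mul_of_nonneg_left h₂ (abs_nonneg e)]

variable {N : ℕ} {C : ℝ} {E : Fin N → ℝ}

theorem rpow_mul_abs_potential_le (hM : 1 ≤ M) (hα : 0 < α) (hα2 : α < 2) (hC : 0 ≤ C)
    (hE : ∀ k, 2 * |E k| ≤ M ^ (α / 2)) {x : ℝ} (hx : 0 < x) (y : Fin N → ℝ) :
    x ^ (1 - α / 2) * |(|x| ^ α - weight M x ^ α - resonantPotential M α C E x y)| ≤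
      M * x ^ (-(1 - α / 2)) + ∑ k, C * (1 + |E k| * x ^ (-α)) := by
  have hw := weight_pos hM x
  have hxw : x ≤ weight M x := (le_abs_self x).trans (abs_le_weight hM x)
  have hx0 := Real.rpow_nonneg hx.le (1 - α / 2)
  rw [abs_of_pos hx]
  have htri : |x ^ α - weight M x ^ α - resonantPotential M α C E x y| ≤
      M * weight M x ^ (α - 2) + |resonantPotential M α C E x y| := by
    refine (abs_sub _ _).trans (add_le_add_left ?_ _)
    rw [abs_sub_comm, abs_of_nonneg (weight_rpow_sub_rpow_nonneg hM hα hx)]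
    exact weight_rpow_sub_rpow_le hM hα2 hx
  refine (mul_le_mul_of_nonneg_left htri hx0).trans ?_
  rw [mul_add]
  refine add_le_add ?_ ?_
  · have h₁ : weight M x ^ (α - 2) ≤ x ^ (α - 2) :=
      Real.rpow_le_rpow_of_nonpos hx hxw (by linarith)
    calc _ ≤ x ^ (1 - α / 2) * (M * x ^ (α - 2)) := by gcongr
      _ = M * (x ^ (1 - α / 2) * x ^ (α - 2)) := by ring
      _ = M * x ^ (-(1 - α / 2)) := by
        rw [← Real.rpow_add hx]
        ring_nf
  · rw [resonantPotential]
    refine (mul_le_mul_of_nonneg_left (Finset.abs_sum_le_sum_abs _ _) hx0).trans ?_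
    rw [Finset.mul_sum]
    refine Finset.sum_le_sum fun k _ => ?_
    have hp := momentum_pos hM hα (hE k) x
    rw [abs_mul, abs_of_nonneg (by positivity)]
    have h₁ : x ^ (1 - α / 2) ≤ weight M x ^ (1 - α / 2) :=
      Real.rpow_le_rpow hx.le hxw (by linarith)
    have h₂ : weight M x ^ (1 - α / 2) * weight M x ^ (α / 2) = weight M x := by
      rw [← Real.rpow_add hw]
      norm_num
    calc x ^ (1 - α / 2) * (C / weight M x * momentum M α (E k) x * |Real.sin (2 * y k)|)
        ≤ weight M x ^ (1 - α / 2) * (C / weight M x *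
            (weight M x ^ (α / 2) * (1 + |E k| * x ^ (-α))) * 1) := by
          gcongr
          · exact momentum_le_rpow hM hα (hE k) hx
          · exact Real.abs_sin_le_one _
      _ = weight M x ^ (1 - α / 2) * weight M x ^ (α / 2) / weight M x *
            (C * (1 + |E k| * x ^ (-α))) := by ring
      _ = C * (1 + |E k| * x ^ (-α)) := by
          rw [h₂, div_self hw.ne', one_mul]

theorem tendsto_potential_bound (M : ℝ) (hα : 0 < α) (hα2 : α < 2) (C : ℝ) (E : Fin N → ℝ) :
    Tendsto (fun x : ℝ => M * x ^ (-(1 - α / 2)) + ∑ k, C * (1 + |E k| * x ^ (-α))) atTop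
      (nhds (C * N)) := by
  have h₁ := (tendsto_rpow_neg_atTop (by linarith : 0 < 1 - α / 2)).const_mul M
  have h₂ : Tendsto (fun x : ℝ => ∑ k, C * (1 + |E k| * x ^ (-α))) atTop
      (nhds (∑ k, C * (1 + |E k| * 0))) :=
    tendsto_finsetSum _ fun k _ =>
      (((tendsto_rpow_neg_atTop hα).const_mul |E k|).const_add 1).const_mul C
  convert h₁.add h₂ using 2
  simp [mul_comm]

theorem integrableOn_sq_of_le (hM : 1 ≤ M) (hC : 2 - α < C) {u : ℝ → ℝ}
    (hu : ContinuousOn u (Ioi 0)) {B : ℝ}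
    (hle : ∀ x, 0 ≤ x → u x ^ 2 ≤ B * weight M x ^ (-(C / 2 + α / 2))) :
    IntegrableOn (fun x => u x ^ 2) (Ioi 0) := by
  have hint := (integrable_weight_rpow hM (s := C / 2 + α / 2) (by linarith)).const_mul B
  refine hint.integrableOn.mono' ((hu.pow 2).aestronglyMeasurable measurableSet_Ioi) ?_
  refine (ae_restrict_iff' measurableSet_Ioi).2 (Eventually.of_forall fun x hx => ?_)
  rw [Real.norm_of_nonneg (sq_nonneg _)]
  exact hle x (le_of_lt hx)

end Asymptotics

/-- For `0 < α < 2`, any `ε > 0`, distinct energies `E_1, …, E_N` and angles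
`θ_1, …, θ_N ∈ [0,π]`, there is a locally `L¹` potential `q` on `[0,∞)` with
`limsup_{x→∞} x^{1-α/2}|q x| ≤ (2-α+ε) N` such that for each `j` the equation
`-u'' - x^α u + q u = E_j u` has a nonzero `L²(0,∞)` solution satisfying
`u'(0) cos θ_j = u(0) sin θ_j`. -/
theorem stmt3 (α : ℝ) (hα0 : 0 < α) (hα2 : α < 2)
    (ε : ℝ) (hε : 0 < ε)
    (N : ℕ) (hN : 1 ≤ N)
    (E : Fin N → ℝ) (hE : Function.Injective E)
    (θ : Fin N → ℝ) (hθ : ∀ j, θ j ∈ Icc 0 Real.pi) :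
    ∃ q : ℝ → ℝ, LocallyIntegrableOn q (Ici 0) ∧
      limsup (fun x : ℝ => ((x ^ (1 - α / 2) * |q x| : ℝ) : EReal)) atTop
        ≤ (((2 - α + ε) * N : ℝ) : EReal) ∧
      ∀ j : Fin N, ∃ u u' u'' : ℝ → ℝ,
        (∃ x ∈ Ici (0 : ℝ), u x ≠ 0) ∧
        (∀ x ∈ Ici (0 : ℝ), HasDerivAt u (u' x) x) ∧
        (∀ x ∈ Ici (0 : ℝ), HasDerivAt u' (u'' x) x) ∧
        (∀ x ∈ Ioi (0 : ℝ), -u'' x - x ^ α * u x + q x * u x = E j * u x) ∧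
        IntegrableOn (fun x => (u x) ^ 2) (Ioi 0) ∧
        u' 0 * Real.cos (θ j) = u 0 * Real.sin (θ j) := by
  obtain ⟨M, hM, hME⟩ := exists_weight_parameter hα0 E
  set C : ℝ := 2 - α + ε / 2 with hCdef
  have hC : 0 ≤ C := by linarith
  choose y₀ hy₀ using fun j => exists_cos_mul_eq_sin_mul (Real.sin (θ j))
    (momentum M α (E j) 0 * Real.cos (θ j))
  obtain ⟨φ, hφ0, hφ⟩ := exists_pruefer_angles hM hα0 hC hME y₀
  have hφc : Continuous φ := continuous_iff_continuousAt.2 fun x => (hφ x).continuousAt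
  refine ⟨fun x => |x| ^ α - weight M x ^ α - resonantPotential M α C E x (φ x), ?_, ?_,
    fun j => ?_⟩
  · refine Continuous.locallyIntegrable ?_ |>.locallyIntegrableOn _
    exact ((continuous_abs.rpow_const fun x => Or.inr hα0.le).sub
      ((continuous_weight M).rpow_const fun x => Or.inr hα0.le)).sub
      (continuous_resonantPotential hM hα0 hME hφc)
  · refine limsup_le_of_le (h := ?_)
    have hlt : C * N < (2 - α + ε) * N := by
      have : (1 : ℝ) ≤ N := by exact_mod_cast hN
      nlinarith
    filter_upwards [eventually_gt_atTop 0,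
      (tendsto_potential_bound M hα0 hα2 C E).eventually_lt_const hlt] with x hx hlt
    exact EReal.coe_le_coe ((rpow_mul_abs_potential_le hM hα0 hα2 hC hME hx (φ x)).trans hlt.le)
  · set ρ : ℝ → ℝ := fun x => ∫ t in (0 : ℝ)..x, radialRate M α C E j t (φ t) with hρdef
    have hρ : ∀ x, HasDerivAt ρ (radialRate M α C E j x (φ x)) x := fun x =>
      ((continuous_radialRate hM hα0 hME j hφc).integral_hasStrictDerivAt 0 x).hasDerivAt
    set s : ℝ → ℝ := fun x => √(momentum M α (E j) x) with hsdef
    have hp := momentum_pos hM hα0 (hME j)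
    have hs0 : ∀ x, 0 < s x := fun x => Real.sqrt_pos.2 (hp x)
    have hs2 : ∀ x, s x ^ 2 = momentum M α (E j) x := fun x => Real.sq_sqrt (hp x).le
    have hsd : ∀ x, HasDerivAt s (momentumRate M α (E j) x * s x) x := fun x => by
      refine ((hasDerivAt_momentum hM hα0 (hME j) x).sqrt (hp x).ne').congr_deriv ?_
      change _ / (2 * s x) = _
      have := (hs0 x).ne'
      rw [← hs2 x]
      field_simp
    have hφj := fun x => hasDerivAt_pi.1 (hφ x) j
    have hu : ∀ x, HasDerivAt (fun x => Real.exp (ρ x) * Real.sin (φ x j) / s x)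
        (Real.exp (ρ x) * Real.cos (φ x j) * s x) x := fun x =>
      hasDerivAt_pruefer_solution (φ := fun x => φ x j) (hp x) (hs2 x) (hsd x) (hφj x) (hρ x)
    have hu' : ∀ x, HasDerivAt (fun x => Real.exp (ρ x) * Real.cos (φ x j) * s x)
        (-(momentum M α (E j) x ^ 2 + resonantPotential M α C E x (φ x)) *
          (Real.exp (ρ x) * Real.sin (φ x j) / s x)) x := fun x =>
      hasDerivAt_deriv_pruefer_solution (φ := fun x => φ x j) (hp x) (hs2 x) (hsd x) (hφj x) (hρ x)
    refine ⟨_, _, _, exists_pruefer_solution_ne_zero (R := fun x => Real.exp (ρ x))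
      (φ := fun x => φ x j) (fun x _ => hu x) (fun _ => rfl) (fun _ => rfl)
      (fun _ => Real.exp_pos _) hs0, fun x _ => hu x, fun x _ => hu' x, fun x hx => ?_, ?_, ?_⟩
    · beta_reduce
      rw [sq_momentum hM hα0 (hME j), abs_of_pos (mem_Ioi.1 hx)]
      ring
    · obtain ⟨B, hB⟩ := exists_radius_le hM hα0 hα2 hC hME hE hφ j hρ
      refine integrableOn_sq_of_le (B := B ^ 2 * 2) hM (by linarith : 2 - α < C)
        (fun x _ => (hu x).continuousAt.continuousWithinAt) fun x hx => ?_
      have hw := weight_pos hM x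
      rw [div_pow, mul_pow, hs2, div_eq_mul_inv]
      calc Real.exp (ρ x) ^ 2 * Real.sin (φ x j) ^ 2 * (momentum M α (E j) x)⁻¹
          ≤ (B * weight M x ^ (-(C / 4))) ^ 2 * 1 * (2 * weight M x ^ (-(α / 2))) := by
            have := inv_pos.2 (hp x)
            gcongr
            · exact hB x hx
            · exact Real.sin_sq_le_one _
            · exact inv_momentum_le hM hα0 (hME j) x
        _ = B ^ 2 * 2 * (weight M x ^ (-(C / 4)) * weight M x ^ (-(C / 4)) *
              weight M x ^ (-(α / 2))) := by ring
        _ = B ^ 2 * 2 * weight M x ^ (-(C / 2 + α / 2)) := by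
            rw [← Real.rpow_add hw, ← Real.rpow_add hw]
            ring_nf
    · simp only [hφ0]
      have hs := (hs0 0).ne'
      have h := hy₀ j
      rw [← hs2 0] at h
      field_simp
      linear_combination h
end

section
/- Let 0 < α < 2, a > 0, and let E_1, …, E_N be distinct positive real numbers with phases t_1, …, t_N ∈ ℝ. Define V(ξ) = 0 for ξ ∈ [0,1] and V(ξ) = (4a/ξ) Σ_{j=1}^N sin( 2∫₀^{ξ} √(1 - β_{E_j}(x)) dx + 2t_j ) for ξ > 1, and Q(ξ,E) = ( α(α-1)/(2+α)² - (5/4)α²/(2+α)² ) ξ^{-2} + β_E(ξ) + V(ξ). If E > 0 and E ∉ {E_1, …, E_N}, then there exist a phase t ∈ ℝ, constants C > 0 and ε > 0, and two linearly independent solutions y₁, y₂ of -y''(ξ) + Q(ξ,E) y(ξ) = y(ξ) on (1,∞) such that for all ξ ≥ 2: |y₁(ξ) - cos(∫₀^{ξ}√(1-β_E(x))dx + t)| ≤ C ξ^{-ε}, |y₁'(ξ) + sin(∫₀^{ξ}√(1-β_E(x))dx + t)| ≤ C ξ^{-ε}, |y₂(ξ) - sin(∫₀^{ξ}√(1-β_E(x))dx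 + t)| ≤ C ξ^{-ε}, and |y₂'(ξ) - cos(∫₀^{ξ}√(1-β_E(x))dx + t)| ≤ C ξ^{-ε}. -/
open Filter Set

/-- Global solvability of a linear ODE with continuous coefficients, by the Volterra series. -/
theorem exists_linear_ode_solution {F : Type*} [NormedAddCommGroup F] [NormedSpace ℝ F]
    [CompleteSpace F] (A : ℝ → F →L[ℝ] F) (hA : Continuous A) (t₀ : ℝ) (x₀ : F) :
    ∃ Y : ℝ → F, Y t₀ = x₀ ∧ ∀ t, HasDerivAt Y (A t (Y t)) t := by
  obtain ⟨S, hS0, hSs⟩ : ∃ S : ℕ → ℝ → F, (S 0 = fun _ => x₀) ∧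
      ∀ n, S (n + 1) = fun t => ∫ s in t₀..t, A s (S n s) :=
    ⟨fun n => Nat.rec (fun _ => x₀) (fun _ f t => ∫ s in t₀..t, A s (f s)) n, rfl, fun _ => rfl⟩
  have hcont : ∀ n, Continuous (S n) := by
    intro n
    induction n with
    | zero => rw [hS0]; exact continuous_const
    | succ n ih =>
      rw [hSs]
      exact intervalIntegral.continuous_primitive
        (fun a b => (hA.clm_apply ih).intervalIntegrable a b) t₀
  have hderiv : ∀ n t, HasDerivAt (S (n + 1)) (A t (S n t)) t := by
    intro n t
    rw [hSs]
    exact intervalIntegral.integral_hasDerivAt_right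
      ((hA.clm_apply (hcont n)).intervalIntegrable _ _)
      ((hA.clm_apply (hcont n)).stronglyMeasurableAtFilter _ _)
      (hA.clm_apply (hcont n)).continuousAt
  have hbase : ∀ n, S (n + 1) t₀ = 0 := by intro n; rw [hSs]; simp
  have key : ∀ T : ℝ, 0 < T → ∃ M : ℝ, 0 ≤ M ∧ (∀ t, |t - t₀| ≤ T → ‖A t‖ ≤ M) ∧
      ∀ n t, |t - t₀| ≤ T → ‖S n t‖ ≤ ‖x₀‖ * ((M * T) ^ n / n.factorial) := by
    intro T hT
    obtain ⟨M, hM⟩ := (isCompact_Icc (a := t₀ - T) (b := t₀ + T)).exists_bound_of_continuousOn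
      hA.continuousOn
    have hM' : ∀ t, |t - t₀| ≤ T → ‖A t‖ ≤ M := fun t ht =>
      hM t ⟨by linarith [(abs_le.1 ht).1], by linarith [(abs_le.1 ht).2]⟩
    have hM0 : 0 ≤ M := (norm_nonneg _).trans (hM' t₀ (by simpa using hT.le))
    refine ⟨M, hM0, hM', ?_⟩
    have h1 : ∀ n t, |t - t₀| ≤ T →
        ‖S n t‖ ≤ ‖x₀‖ * (M ^ n / n.factorial) * |t - t₀| ^ n := by
      intro n
      induction n with
      | zero => intro t _; simp [hS0]
      | succ n ih =>
        intro t ht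
        rw [hSs]
        calc ‖∫ s in t₀..t, A s (S n s)‖ ≤ ∫ s in uIoc t₀ t, ‖A s (S n s)‖ :=
              intervalIntegral.norm_integral_le_integral_norm_uIoc
          _ ≤ ∫ s in uIoc t₀ t, M * (‖x₀‖ * (M ^ n / n.factorial)) * |s - t₀| ^ n := by
              refine MeasureTheory.setIntegral_mono_on ?_ ?_ measurableSet_uIoc ?_
              · exact ((hA.clm_apply (hcont n)).norm).integrableOn_uIoc
              · exact Continuous.integrableOn_uIoc (by fun_prop)
              · intro s hs
                have hs' : |s - t₀| ≤ T :=
                  (abs_sub_left_of_mem_uIcc (uIoc_subset_uIcc hs)).trans ht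
                calc ‖A s (S n s)‖ ≤ ‖A s‖ * ‖S n s‖ := (A s).le_opNorm _
                  _ ≤ M * (‖x₀‖ * (M ^ n / n.factorial) * |s - t₀| ^ n) :=
                    mul_le_mul (hM' s hs') (ih s hs') (norm_nonneg _) hM0
                  _ = _ := by ring
          _ = ‖x₀‖ * (M ^ (n + 1) / (n + 1).factorial) * |t - t₀| ^ (n + 1) := by
              rw [MeasureTheory.integral_const_mul, integral_pow_abs_sub_uIoc, Nat.factorial_succ]
              push_cast
              field_simp
              ring
    intro n t ht
    refine (h1 n t ht).trans ?_
    rw [mul_pow]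
    have : |t - t₀| ^ n ≤ T ^ n := pow_le_pow_left₀ (abs_nonneg _) ht n
    calc ‖x₀‖ * (M ^ n / n.factorial) * |t - t₀| ^ n ≤ ‖x₀‖ * (M ^ n / n.factorial) * T ^ n := by
          gcongr
      _ = _ := by ring
  have hsum : ∀ t, Summable fun n => S n t := by
    intro t
    obtain ⟨M, -, -, h⟩ := key (|t - t₀| + 1) (by positivity)
    exact Summable.of_norm_bounded ((Real.summable_pow_div_factorial _).mul_left _)
      (fun n => h n t (by linarith))
  refine ⟨fun t => ∑' n, S n t, ?_, ?_⟩
  · simp only []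
    rw [tsum_eq_single 0]
    · rw [hS0]
    · intro n hn
      obtain ⟨k, rfl⟩ := Nat.exists_eq_succ_of_ne_zero hn
      exact hbase k
  · intro t
    obtain ⟨M, hM0, hM, h⟩ := key (|t - t₀| + 1) (by positivity)
    have htail : ∀ s, ∑' n, S n s = x₀ + ∑' n, S (n + 1) s := by
      intro s
      rw [(hsum s).tsum_eq_zero_add, hS0]
    have hd : HasDerivAt (fun s => ∑' n, S (n + 1) s) (∑' n, A t (S n t)) t := by
      refine hasDerivAt_tsum_of_isPreconnected (g := fun n => S (n + 1))
        (g' := fun n y => A y (S n y)) (t := Metric.ball t₀ (|t - t₀| + 1))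
        (u := fun n => M * (‖x₀‖ * ((M * (|t - t₀| + 1)) ^ n / n.factorial))) (y₀ := t₀)
        (((Real.summable_pow_div_factorial _).mul_left _).mul_left _) Metric.isOpen_ball
        (convex_ball _ _).isPreconnected (fun n y _ => hderiv n y) ?_ ?_ ?_ ?_
      · intro n y hy
        have hy' : |y - t₀| ≤ |t - t₀| + 1 := (Metric.mem_ball.1 hy).le
        exact ((A y).le_opNorm _).trans
          (mul_le_mul (hM y hy') (h n y hy') (norm_nonneg _) hM0)
      · exact Metric.mem_ball_self (by positivity)
      · simp only [hbase]; exact summable_zero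
      · rw [Metric.mem_ball, Real.dist_eq]; linarith
    rw [(A t).map_tsum (hsum t)]
    have := hd.const_add x₀
    exact this.congr_of_eventuallyEq (Eventually.of_forall htail)

/-- If `‖u'‖ ≤ C x^{-1-δ} ‖u‖` near infinity then `u` converges with rate `x^{-δ}`. -/
theorem exists_limit_of_norm_deriv_le {u u' : ℝ → ℂ} {δ C X : ℝ} (hδ : 0 < δ) (hC : 0 ≤ C)
    (hX : 1 ≤ X) (hu : ∀ x, X ≤ x → HasDerivAt u (u' x) x)
    (hb : ∀ x, X ≤ x → ‖u' x‖ ≤ C * x ^ (-1 - δ) * ‖u x‖) :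
    ∃ L : ℂ, ∃ B : ℝ, 0 ≤ B ∧ ∀ x, X ≤ x → ‖u x - L‖ ≤ B * x ^ (-δ) := by
  have hrp : ∀ x : ℝ, X ≤ x → HasDerivAt (fun x : ℝ => x ^ (-δ)) (-δ * x ^ (-1 - δ)) x := by
    intro x hx
    have := Real.hasDerivAt_rpow_const (x := x) (p := -δ) (Or.inl (by linarith))
    convert this using 2
    ring_nf
  let Nf : ℝ → ℝ := fun x => ‖u x‖ ^ 2 * Real.exp (2 * C / δ * x ^ (-δ))
  have hN : ∀ x, X ≤ x → HasDerivAt Nf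
      (2 * inner ℝ (u x) (u' x) * Real.exp (2 * C / δ * x ^ (-δ)) +
        ‖u x‖ ^ 2 * (Real.exp (2 * C / δ * x ^ (-δ)) * (2 * C / δ * (-δ * x ^ (-1 - δ))))) x := by
    intro x hx
    exact (hu x hx).norm_sq.mul (((hrp x hx).const_mul _).exp)
  have hanti : AntitoneOn Nf (Ici X) := by
    refine antitoneOn_of_deriv_nonpos (convex_Ici X)
      (fun x hx => (hN x hx).continuousAt.continuousWithinAt)
      (fun x hx => ((hN x (interior_subset hx)).differentiableAt).differentiableWithinAt) ?_
    intro x hx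
    have hx : X ≤ x := interior_subset hx
    rw [(hN x hx).deriv]
    have h1 : inner ℝ (u x) (u' x) ≤ ‖u x‖ * (C * x ^ (-1 - δ) * ‖u x‖) :=
      (real_inner_le_norm _ _).trans (mul_le_mul_of_nonneg_left (hb x hx) (norm_nonneg _))
    have h2 : 2 * C / δ * (-δ * x ^ (-1 - δ)) = - (2 * C * x ^ (-1 - δ)) := by
      field_simp
    rw [h2]
    have h3 := Real.exp_pos (2 * C / δ * x ^ (-δ))
    nlinarith [mul_le_mul_of_nonneg_right h1 h3.le]
  obtain ⟨K, hK0, hK⟩ : ∃ K : ℝ, 0 ≤ K ∧ ∀ x, X ≤ x → ‖u x‖ ≤ K := by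
    refine ⟨√(Nf X), Real.sqrt_nonneg _, fun x hx => ?_⟩
    apply Real.le_sqrt_of_sq_le
    refine le_trans ?_ (hanti (mem_Ici.2 le_rfl) (mem_Ici.2 hx) hx)
    have : 1 ≤ Real.exp (2 * C / δ * x ^ (-δ)) := by
      apply Real.one_le_exp
      have : 0 ≤ x := by linarith
      positivity
    exact le_mul_of_one_le_right (by positivity) this
  have hdist : ∀ x y, X ≤ x → x ≤ y → ‖u y - u x‖ ≤ C * K / δ * x ^ (-δ) := by
    intro x y hx hxy
    have hx0 : 0 < x := by linarith
    have := image_norm_le_of_norm_deriv_right_le_deriv_boundary' (f := fun y => u y - u x) (f' := u')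
      (a := x) (b := y) (B := fun y => C * K / δ * (x ^ (-δ) - y ^ (-δ)))
      (B' := fun y => C * K / δ * (-(-δ * y ^ (-1 - δ))))
      (fun z hz => (((hu z (hx.trans hz.1)).sub_const _).continuousAt).continuousWithinAt)
      (fun z hz => ((hu z (hx.trans hz.1)).sub_const _).hasDerivWithinAt) (by simp)
      (fun z hz => (((hrp z (hx.trans hz.1)).const_sub _).const_mul _).continuousAt.continuousWithinAt)
      (fun z hz => (((hrp z (hx.trans hz.1)).const_sub _).const_mul _).hasDerivWithinAt) ?_
      (right_mem_Icc.2 hxy)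
    · refine this.trans ?_
      have : 0 ≤ y ^ (-δ) := Real.rpow_nonneg (by linarith) _
      have h0 : 0 ≤ C * K / δ := by positivity
      nlinarith
    · intro z hz
      refine (hb z (hx.trans hz.1)).trans ?_
      have hz0 : 0 ≤ z := by linarith [hz.1]
      calc C * z ^ (-1 - δ) * ‖u z‖ ≤ C * z ^ (-1 - δ) * K := by
            gcongr
            exact hK z (hx.trans hz.1)
        _ = _ := by field_simp
  have hcauchy : CauchySeq fun x : ℝ => u (max x X) := by
    refine cauchySeq_of_le_tendsto_0' (fun x => C * K / δ * (max x X) ^ (-δ)) ?_ ?_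
    · intro n m hnm
      rw [dist_comm, dist_eq_norm]
      exact hdist _ _ (le_max_right _ _) (max_le_max_right _ hnm)
    · rw [show (0 : ℝ) = C * K / δ * 0 by simp]
      refine Tendsto.const_mul _ ((tendsto_rpow_neg_atTop hδ).comp ?_)
      exact tendsto_atTop_mono (fun x => le_max_left x X) tendsto_id
  obtain ⟨L, hL⟩ := cauchySeq_tendsto_of_complete hcauchy
  refine ⟨L, C * K / δ, by positivity, fun x hx => ?_⟩
  have h1 : Tendsto (fun y : ℝ => ‖u x - u (max y X)‖) atTop (nhds ‖u x - L‖) :=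
    (hL.const_sub _).norm
  refine le_of_tendsto h1 ?_
  filter_upwards [eventually_ge_atTop x] with y hy
  rw [norm_sub_rev]
  exact hdist _ _ hx (hy.trans (le_max_left _ _))

/-- `f` has an approximate primitive of size `x^{-δ}`, up to an error `O(x^{-1-δ})`. -/
def HasSmallPrimitive (δ : ℝ) (f : ℝ → ℂ) : Prop :=
  ∃ F F' : ℝ → ℂ, ∃ C : ℝ, ∀ x : ℝ, 1 < x →
    HasDerivAt F (F' x) x ∧ ‖F x‖ ≤ C * x ^ (-δ) ∧ ‖F' x - f x‖ ≤ C * x ^ (-1 - δ)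

theorem HasSmallPrimitive.const_mul {δ : ℝ} {f : ℝ → ℂ} (hf : HasSmallPrimitive δ f) (k : ℂ) :
    HasSmallPrimitive δ fun x => k * f x := by
  obtain ⟨F, F', C, h⟩ := hf
  refine ⟨fun x => k * F x, fun x => k * F' x, ‖k‖ * C, fun x hx => ?_⟩
  obtain ⟨h1, h2, h3⟩ := h x hx
  refine ⟨h1.const_mul k, ?_, ?_⟩
  · rw [norm_mul, mul_assoc]; gcongr
  · rw [← mul_sub, norm_mul, mul_assoc]; gcongr

theorem HasSmallPrimitive.add {δ : ℝ} {f g : ℝ → ℂ} (hf : HasSmallPrimitive δ f)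
    (hg : HasSmallPrimitive δ g) : HasSmallPrimitive δ fun x => f x + g x := by
  obtain ⟨F, F', C, h⟩ := hf
  obtain ⟨G, G', D, k⟩ := hg
  refine ⟨fun x => F x + G x, fun x => F' x + G' x, C + D, fun x hx => ?_⟩
  obtain ⟨h1, h2, h3⟩ := h x hx
  obtain ⟨k1, k2, k3⟩ := k x hx
  refine ⟨h1.add k1, ?_, ?_⟩
  · rw [add_mul]; exact norm_add_le_of_le h2 k2
  · rw [add_mul, add_sub_add_comm]; exact norm_add_le_of_le h3 k3

theorem HasSmallPrimitive.sum {δ : ℝ} {ι : Type*} (s : Finset ι) {f : ι → ℝ → ℂ}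
    (hf : ∀ i, HasSmallPrimitive δ (f i)) : HasSmallPrimitive δ fun x => ∑ i ∈ s, f i x := by
  classical
  induction s using Finset.induction_on with
  | empty => exact ⟨0, 0, 0, fun x _ => ⟨by simp [Pi.zero_def, hasDerivAt_const], by simp, by simp⟩⟩
  | insert i s hi ih =>
    simp only [Finset.sum_insert hi]
    exact (hf i).add ih

theorem HasSmallPrimitive.conj {δ : ℝ} {f : ℝ → ℂ} (hf : HasSmallPrimitive δ f) :
    HasSmallPrimitive δ fun x => (starRingEnd ℂ) (f x) := by
  obtain ⟨F, F', C, h⟩ := hf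
  refine ⟨fun x => (starRingEnd ℂ) (F x), fun x => (starRingEnd ℂ) (F' x), C, fun x hx => ?_⟩
  obtain ⟨h1, h2, h3⟩ := h x hx
  refine ⟨h1.star, ?_, ?_⟩
  · rwa [Complex.norm_conj]
  · rwa [← map_sub, Complex.norm_conj]

theorem HasSmallPrimitive.congr {δ : ℝ} {f g : ℝ → ℂ} (hf : HasSmallPrimitive δ f)
    (hfg : ∀ x, 1 < x → f x = g x) : HasSmallPrimitive δ g := by
  obtain ⟨F, F', C, h⟩ := hf
  exact ⟨F, F', C, fun x hx => by rw [← hfg x hx]; exact h x hx⟩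

theorem HasSmallPrimitive.exists_limit {δ C : ℝ} {g h w w' : ℝ → ℂ} (hδ : 0 < δ)
    (hg : HasSmallPrimitive δ g) (hh : HasSmallPrimitive δ h)
    (hgb : ∀ x, 1 < x → ‖g x‖ ≤ C * x⁻¹) (hhb : ∀ x, 1 < x → ‖h x‖ ≤ C * x⁻¹)
    (hw : ∀ x, 1 < x → HasDerivAt w (w' x) x)
    (hb : ∀ x, 1 < x → ‖w' x - (g x * w x + h x * (starRingEnd ℂ) (w x))‖
      ≤ C * x ^ (-1 - δ) * ‖w x‖) :
    ∃ L : ℂ, ∃ B : ℝ, 0 ≤ B ∧ ∀ x, 2 ≤ x → ‖w x - L‖ ≤ B * x ^ (-δ) := by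
  obtain ⟨G, G', CG, hG⟩ := hg
  obtain ⟨H, H', CH, hH⟩ := hh
  obtain ⟨M, hM0, hMC, hMG, hMH⟩ : ∃ M : ℝ, 0 < M ∧ C ≤ M ∧ CG ≤ M ∧ CH ≤ M :=
    ⟨|C| + |CG| + |CH| + 1, by positivity,
      by linarith [le_abs_self C, abs_nonneg CG, abs_nonneg CH],
      by linarith [le_abs_self CG, abs_nonneg C, abs_nonneg CH],
      by linarith [le_abs_self CH, abs_nonneg CG, abs_nonneg C]⟩
  obtain ⟨X₀, hX₀⟩ := eventually_atTop.1
    ((tendsto_rpow_neg_atTop hδ).eventually (ge_mem_nhds (show 0 < 1 / (4 * M) by positivity)))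
  obtain ⟨X, hX2, hX⟩ : ∃ X : ℝ, 2 ≤ X ∧ ∀ x, X ≤ x → x ^ (-δ) ≤ 1 / (4 * M) :=
    ⟨max X₀ 2, le_max_right _ _, fun x hx => hX₀ x ((le_max_left _ _).trans hx)⟩
  let u : ℝ → ℂ := fun x => w x - G x * w x - H x * (starRingEnd ℂ) (w x)
  let u' : ℝ → ℂ := fun x => w' x - (G' x * w x + G x * w' x)
    - (H' x * (starRingEnd ℂ) (w x) + H x * (starRingEnd ℂ) (w' x))
  have hu : ∀ x, X ≤ x → HasDerivAt u (u' x) x := by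
    intro x hx
    have hx1 : 1 < x := by linarith
    exact ((hw x hx1).sub ((hG x hx1).1.mul (hw x hx1))).sub ((hH x hx1).1.mul (hw x hx1).star)
  have hGs : ∀ x, 1 < x → ‖G x‖ ≤ M * x ^ (-δ) := fun x hx =>
    (hG x hx).2.1.trans (by gcongr)
  have hHs : ∀ x, 1 < x → ‖H x‖ ≤ M * x ^ (-δ) := fun x hx =>
    (hH x hx).2.1.trans (by gcongr)
  have hwu : ∀ x, X ≤ x → ‖u x - w x‖ ≤ 2 * M * x ^ (-δ) * ‖w x‖ := by
    intro x hx
    have hx1 : 1 < x := by linarith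
    have : u x - w x = -(G x * w x) - H x * (starRingEnd ℂ) (w x) := by simp only [u]; ring
    rw [this]
    refine (norm_sub_le _ _).trans ?_
    rw [norm_neg, norm_mul, norm_mul, Complex.norm_conj]
    nlinarith [hGs x hx1, hHs x hx1, norm_nonneg (w x)]
  have hw2 : ∀ x, X ≤ x → ‖w x‖ ≤ 2 * ‖u x‖ := by
    intro x hx
    have h1 := hwu x hx
    have h2 : 2 * M * x ^ (-δ) ≤ 1 / 2 := by
      have := mul_le_mul_of_nonneg_left (hX x hx) (by positivity : 0 ≤ 2 * M)
      refine this.trans (le_of_eq ?_)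
      field_simp
      norm_num
    have h3 : ‖w x‖ ≤ ‖u x‖ + ‖u x - w x‖ := by
      rw [norm_sub_rev (u x) (w x)]
      have := norm_add_le (u x) (w x - u x)
      rwa [add_sub_cancel] at this
    nlinarith [norm_nonneg (w x)]
  have hub : ∀ x, X ≤ x → ‖u' x‖ ≤ (2 * (3 * M + 6 * M ^ 2)) * x ^ (-1 - δ) * ‖u x‖ := by
    intro x hx
    have hx1 : 1 < x := by linarith
    have hx0 : 0 < x := by linarith
    have hs1 : x ^ (-δ) ≤ 1 := Real.rpow_le_one_of_one_le_of_nonpos hx1.le (by linarith)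
    have hs0 : 0 ≤ x ^ (-δ) := Real.rpow_nonneg hx0.le _
    have hr0 : 0 < x⁻¹ := by positivity
    have hrs : x ^ (-1 - δ) = x⁻¹ * x ^ (-δ) := by
      rw [sub_eq_add_neg, Real.rpow_add hx0, Real.rpow_neg_one]
    have hG' : ‖G' x - g x‖ ≤ M * (x⁻¹ * x ^ (-δ)) :=
      hrs ▸ (hG x hx1).2.2.trans (by gcongr)
    have hH' : ‖H' x - h x‖ ≤ M * (x⁻¹ * x ^ (-δ)) :=
      hrs ▸ (hH x hx1).2.2.trans (by gcongr)
    have hg' : ‖g x‖ ≤ M * x⁻¹ := (hgb x hx1).trans (by gcongr)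
    have hh' : ‖h x‖ ≤ M * x⁻¹ := (hhb x hx1).trans (by gcongr)
    have hb' : ‖w' x - (g x * w x + h x * (starRingEnd ℂ) (w x))‖
        ≤ M * (x⁻¹ * x ^ (-δ)) * ‖w x‖ := hrs ▸ (hb x hx1).trans (by gcongr)
    have hw'b : ‖w' x‖ ≤ 3 * M * x⁻¹ * ‖w x‖ := by
      have e : w' x = (w' x - (g x * w x + h x * (starRingEnd ℂ) (w x)))
        + (g x * w x + h x * (starRingEnd ℂ) (w x)) := by ring
      have h1 : ‖g x * w x + h x * (starRingEnd ℂ) (w x)‖ ≤ M * x⁻¹ * ‖w x‖ + M * x⁻¹ * ‖w x‖ := by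
        refine norm_add_le_of_le ?_ ?_
        · rw [norm_mul]; gcongr
        · rw [norm_mul, Complex.norm_conj]; gcongr
      rw [e]
      refine (norm_add_le_of_le hb' h1).trans ?_
      have : M * (x⁻¹ * x ^ (-δ)) * ‖w x‖ ≤ M * (x⁻¹ * 1) * ‖w x‖ := by gcongr
      linarith
    have e : u' x = (w' x - (g x * w x + h x * (starRingEnd ℂ) (w x)))
        + (-((G' x - g x) * w x) + (-((H' x - h x) * (starRingEnd ℂ) (w x))
        + (-(G x * w' x) + -(H x * (starRingEnd ℂ) (w' x))))) := by
      simp only [u']; ring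
    have h1 : ‖(G' x - g x) * w x‖ ≤ M * (x⁻¹ * x ^ (-δ)) * ‖w x‖ := by
      rw [norm_mul]; gcongr
    have h2 : ‖(H' x - h x) * (starRingEnd ℂ) (w x)‖ ≤ M * (x⁻¹ * x ^ (-δ)) * ‖w x‖ := by
      rw [norm_mul, Complex.norm_conj]; gcongr
    have h3 : ‖G x * w' x‖ ≤ M * x ^ (-δ) * (3 * M * x⁻¹ * ‖w x‖) := by
      rw [norm_mul]
      exact mul_le_mul (hGs x hx1) hw'b (norm_nonneg _) (by positivity)
    have h4 : ‖H x * (starRingEnd ℂ) (w' x)‖ ≤ M * x ^ (-δ) * (3 * M * x⁻¹ * ‖w x‖) := by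
      rw [norm_mul, Complex.norm_conj]
      exact mul_le_mul (hHs x hx1) hw'b (norm_nonneg _) (by positivity)
    rw [← norm_neg] at h1 h2 h3 h4
    have htot : ‖u' x‖ ≤ (3 * M + 6 * M ^ 2) * x ^ (-1 - δ) * ‖w x‖ := by
      rw [e]
      refine (norm_add_le_of_le hb' (norm_add_le_of_le h1 (norm_add_le_of_le h2
        (norm_add_le_of_le h3 h4)))).trans (le_of_eq ?_)
      rw [hrs]; ring
    refine htot.trans ?_
    calc (3 * M + 6 * M ^ 2) * x ^ (-1 - δ) * ‖w x‖
        ≤ (3 * M + 6 * M ^ 2) * x ^ (-1 - δ) * (2 * ‖u x‖) := by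
          gcongr
          exact hw2 x hx
      _ = _ := by ring
  obtain ⟨L, B, hB0, hB⟩ := exists_limit_of_norm_deriv_le hδ (by positivity)
    (by linarith : (1 : ℝ) ≤ X) hu hub
  have hwX : ∀ x, X ≤ x → ‖w x - L‖ ≤ (B + 2 * M * (2 * (‖L‖ + B))) * x ^ (-δ) := by
    intro x hx
    have hx1 : 1 < x := by linarith
    have hs1 : x ^ (-δ) ≤ 1 := Real.rpow_le_one_of_one_le_of_nonpos hx1.le (by linarith)
    have hs0 : 0 ≤ x ^ (-δ) := Real.rpow_nonneg (by linarith) _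
    have h1 : ‖u x‖ ≤ ‖L‖ + B := by
      have : ‖u x‖ ≤ ‖L‖ + ‖u x - L‖ := by simpa using norm_add_le L (u x - L)
      nlinarith [hB x hx]
    have h2 : ‖w x - L‖ ≤ ‖u x - L‖ + ‖u x - w x‖ := by
      rw [norm_sub_rev (u x) (w x)]
      have := norm_add_le (u x - L) (w x - u x)
      rwa [show u x - L + (w x - u x) = w x - L by ring] at this
    have h3 : 2 * M * x ^ (-δ) * ‖w x‖ ≤ 2 * M * x ^ (-δ) * (2 * (‖L‖ + B)) := by
      gcongr
      linarith [hw2 x hx]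
    calc ‖w x - L‖ ≤ ‖u x - L‖ + ‖u x - w x‖ := h2
      _ ≤ B * x ^ (-δ) + 2 * M * x ^ (-δ) * (2 * (‖L‖ + B)) :=
        add_le_add (hB x hx) ((hwu x hx).trans h3)
      _ = _ := by ring
  obtain ⟨D, hD⟩ := (isCompact_Icc (a := (2 : ℝ)) (b := X)).exists_bound_of_continuousOn
    (f := fun x => w x - L) (fun x hx =>
      ((hw x (by linarith [hx.1])).continuousAt.sub continuousAt_const).continuousWithinAt)
  have hD0 : 0 ≤ D := (norm_nonneg _).trans (hD 2 ⟨le_rfl, hX2⟩)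
  refine ⟨L, (B + 2 * M * (2 * (‖L‖ + B))) + D * X ^ δ, by positivity, fun x hx => ?_⟩
  have hx0 : 0 < x := by linarith
  rw [add_mul]
  rcases le_total X x with h | h
  · exact (hwX x h).trans (le_add_of_nonneg_right (by positivity))
  · refine (hD x ⟨hx, h⟩).trans (le_trans ?_ (le_add_of_nonneg_left (by positivity)))
    rw [mul_assoc]
    refine le_mul_of_one_le_right hD0 ?_
    rw [Real.rpow_neg hx0.le, ← div_eq_mul_inv, one_le_div (by positivity)]
    gcongr

/-- A non-stationary oscillation `x⁻¹ exp (i φ)` with `|φ'| ≳ x^{-γ}` has a small primitive. -/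
theorem hasSmallPrimitive_exp {γ δ d C : ℝ} (hd : 0 < d) (hδ : δ ≤ 1 - γ) {φ D D' : ℝ → ℝ}
    (hφ : ∀ x, 1 < x → HasDerivAt φ (D x) x) (hD : ∀ x, 1 < x → HasDerivAt D (D' x) x)
    (hlow : ∀ x, 1 < x → d * x ^ (-γ) ≤ |D x|)
    (hup : ∀ x, 1 < x → |D' x| ≤ C * x ^ (-γ - 1)) :
    HasSmallPrimitive δ fun x => (x : ℂ)⁻¹ * Complex.exp (Complex.I * φ x) := by
  let m : ℝ → ℝ := fun x => (x * D x)⁻¹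
  let m' : ℝ → ℝ := fun x => -(1 * D x + x * D' x) / (x * D x) ^ 2
  have hC : 0 ≤ C := by
    have := (abs_nonneg _).trans (hup 2 one_lt_two)
    exact nonneg_of_mul_nonneg_left this (by positivity)
  refine ⟨fun x => -Complex.I * m x * Complex.exp (Complex.I * φ x),
    fun x => -Complex.I * m' x * Complex.exp (Complex.I * φ x)
      + -Complex.I * m x * (Complex.exp (Complex.I * φ x) * (Complex.I * D x)),
    d⁻¹ + C / d ^ 2, fun x hx => ?_⟩
  have hx0 : 0 < x := by linarith
  have hDpos : 0 < |D x| := lt_of_lt_of_le (by positivity) (hlow x hx)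
  have hDne : D x ≠ 0 := abs_pos.1 hDpos
  have hexp : ‖Complex.exp (Complex.I * φ x)‖ = 1 := by
    rw [mul_comm]; exact Complex.norm_exp_ofReal_mul_I _
  have hDinv : |D x|⁻¹ ≤ d⁻¹ * x ^ γ := by
    have := inv_anti₀ (by positivity) (hlow x hx)
    rwa [mul_inv, Real.rpow_neg hx0.le, inv_inv] at this
  have hm : |m x| ≤ d⁻¹ * x ^ (γ - 1) := by
    simp only [m]
    rw [abs_inv, abs_mul, abs_of_pos hx0, mul_inv, Real.rpow_sub_one hx0.ne']
    calc x⁻¹ * |D x|⁻¹ ≤ x⁻¹ * (d⁻¹ * x ^ γ) := by gcongr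
      _ = _ := by ring
  have hm' : |m' x| ≤ (d⁻¹ + C / d ^ 2) * x ^ (γ - 2) := by
    have e : m' x = -(x⁻¹ * x⁻¹ * (D x)⁻¹) - x⁻¹ * D' x * ((D x)⁻¹ * (D x)⁻¹) := by
      simp only [m']; field_simp; ring
    rw [e]
    refine (abs_sub _ _).trans ?_
    rw [abs_neg]
    simp only [abs_mul, abs_inv, abs_of_pos hx0]
    have e1 : x ^ (γ - 2) = x⁻¹ * x⁻¹ * x ^ γ := by
      rw [show γ - 2 = γ - 1 - 1 by ring, Real.rpow_sub_one hx0.ne', Real.rpow_sub_one hx0.ne']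
      field_simp
    have e2 : x ^ (-γ - 1) = x⁻¹ * (x ^ γ)⁻¹ := by
      rw [Real.rpow_sub_one hx0.ne', Real.rpow_neg hx0.le]; field_simp
    have hp : 0 < x ^ γ := by positivity
    calc x⁻¹ * x⁻¹ * |D x|⁻¹ + x⁻¹ * |D' x| * (|D x|⁻¹ * |D x|⁻¹)
        ≤ x⁻¹ * x⁻¹ * (d⁻¹ * x ^ γ)
          + x⁻¹ * (C * x ^ (-γ - 1)) * ((d⁻¹ * x ^ γ) * (d⁻¹ * x ^ γ)) := by
          gcongr
          exact hup x hx
      _ = _ := by rw [e1, e2]; field_simp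
  refine ⟨?_, ?_, ?_⟩
  · have h1 : HasDerivAt m (m' x) x :=
      ((hasDerivAt_id x).mul (hD x hx)).inv (mul_ne_zero hx0.ne' hDne)
    have h2 : HasDerivAt (fun x => Complex.exp (Complex.I * φ x))
        (Complex.exp (Complex.I * φ x) * (Complex.I * D x)) x :=
      ((hφ x hx).ofReal_comp.const_mul _).cexp
    exact (h1.ofReal_comp.const_mul _).mul h2
  · rw [norm_mul, norm_mul, hexp, norm_neg, Complex.norm_I, Complex.norm_real, one_mul, mul_one,
      Real.norm_eq_abs]
    refine hm.trans ?_
    calc d⁻¹ * x ^ (γ - 1) ≤ (d⁻¹ + C / d ^ 2) * x ^ (γ - 1) := by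
          gcongr; linarith [show 0 ≤ C / d ^ 2 by positivity]
      _ ≤ _ := by gcongr; exact hx.le; linarith
  · have e : -Complex.I * m x * (Complex.exp (Complex.I * φ x) * (Complex.I * D x))
        = (x : ℂ)⁻¹ * Complex.exp (Complex.I * φ x) := by
      have : (m x : ℂ) * D x = (x : ℂ)⁻¹ := by
        rw [← Complex.ofReal_mul, ← Complex.ofReal_inv]
        congr 1
        simp only [m]; field_simp
      rw [← this]
      linear_combination (-(m x : ℂ) * D x * Complex.exp (Complex.I * φ x)) * Complex.I_mul_I
    simp only []
    rw [e, add_sub_cancel_right, norm_mul, norm_mul, hexp, norm_neg, Complex.norm_I,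
      Complex.norm_real, one_mul, mul_one, Real.norm_eq_abs]
    exact hm'.trans (mul_le_mul_of_nonneg_left
      (Real.rpow_le_rpow_of_exponent_le hx.le (by linarith)) (by positivity))

/-- Existence for `y'' = q y` on `(1, ∞)` with prescribed data at `2`. -/
theorem exists_second_order_solution {q : ℝ → ℝ} (hq : ContinuousOn q (Ici 1)) (a b : ℝ) :
    ∃ y y' : ℝ → ℝ, y 2 = a ∧ y' 2 = b ∧
      ∀ x, 1 < x → HasDerivAt y (y' x) x ∧ HasDerivAt y' (q x * y x) x := by
  have hq' : Continuous fun x => q (max x 1) :=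
    hq.comp_continuous (by fun_prop) (fun x => mem_Ici.2 (le_max_right _ _))
  let P : ℝ × ℝ →L[ℝ] ℝ × ℝ := (ContinuousLinearMap.snd ℝ ℝ ℝ).prod 0
  let R : ℝ × ℝ →L[ℝ] ℝ × ℝ :=
    (0 : ℝ × ℝ →L[ℝ] ℝ).prod (ContinuousLinearMap.fst ℝ ℝ ℝ)
  obtain ⟨Y, h0, hY⟩ := exists_linear_ode_solution (fun x => P + q (max x 1) • R)
    (continuous_const.add (hq'.smul continuous_const)) 2 (a, b)
  refine ⟨fun x => (Y x).1, fun x => (Y x).2, by simp [h0], by simp [h0], fun x hx => ?_⟩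
  have h : HasDerivAt Y ((Y x).2, q x * (Y x).1) x :=
    (hY x).congr_deriv (by simp [P, R, max_eq_left hx.le])
  exact ⟨(ContinuousLinearMap.fst ℝ ℝ ℝ).hasFDerivAt.comp_hasDerivAt x h,
    (ContinuousLinearMap.snd ℝ ℝ ℝ).hasFDerivAt.comp_hasDerivAt x h⟩

section Asymptotics

variable {δ C : ℝ} {p p' θ U V : ℝ → ℝ}

/-- The slowly varying amplitude `e^{-iθ} (p y - i y')` of a solution of `y'' = -(p² - U) y`
converges. -/
theorem exists_amplitude_limit (hδ : 0 < δ)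
    (hp : ∀ x, 1 < x → 1 ≤ p x) (hp1 : ∀ x, 1 < x → p x - 1 ≤ C * x ^ (-δ))
    (hpd : ∀ x, 1 < x → HasDerivAt p (p' x) x) (hp' : ∀ x, 1 < x → |p' x| ≤ C * x ^ (-1 - δ))
    (hθ : ∀ x, 1 < x → HasDerivAt θ (p x) x)
    (hV : ∀ x, 1 < x → |V x| ≤ C * x⁻¹) (hUV : ∀ x, 1 < x → |U x - V x| ≤ C * x ^ (-1 - δ))
    (hosc : HasSmallPrimitive δ fun x => V x)
    (hosc2 : HasSmallPrimitive δ fun x => V x * Complex.exp (-(2 * Complex.I * θ x)))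
    {y y' : ℝ → ℝ} (hy : ∀ x, 1 < x → HasDerivAt y (y' x) x ∧
      HasDerivAt y' (-(p x ^ 2 - U x) * y x) x) :
    ∃ L : ℂ, ∃ B : ℝ, 0 ≤ B ∧ ∀ x, 2 ≤ x →
      ‖Complex.exp (-(Complex.I * θ x)) * (p x * y x - Complex.I * y' x) - L‖ ≤ B * x ^ (-δ) := by
  have hC : 0 ≤ C := by
    have := (abs_nonneg _).trans (hV 2 one_lt_two)
    exact nonneg_of_mul_nonneg_left this (by positivity)
  have hnorm : ∀ x, ‖Complex.exp (-(Complex.I * θ x))‖ = 1 := by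
    intro x
    rw [show -(Complex.I * θ x) = ((-θ x : ℝ) : ℂ) * Complex.I by push_cast; ring]
    exact Complex.norm_exp_ofReal_mul_I _
  have hnorm2 : ∀ x, ‖Complex.exp (-(2 * Complex.I * θ x))‖ = 1 := by
    intro x
    rw [show -(2 * Complex.I * θ x) = ((-(2 * θ x) : ℝ) : ℂ) * Complex.I by push_cast; ring]
    exact Complex.norm_exp_ofReal_mul_I _
  have hI : ‖(-Complex.I / 2)‖ ≤ 1 := by
    rw [norm_div, norm_neg, Complex.norm_I, Complex.norm_ofNat]; norm_num
  refine HasSmallPrimitive.exists_limit (C := 2 * C + C ^ 2 + C)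
    (w' := fun x => Complex.exp (-(Complex.I * θ x)) * ((p' x - Complex.I * U x) * y x))
    hδ (hosc.const_mul (-Complex.I / 2)) (hosc2.const_mul (-Complex.I / 2)) ?_ ?_ ?_ ?_
  · intro x hx
    have hx0 : 0 < x := by linarith
    rw [norm_mul, Complex.norm_real, Real.norm_eq_abs]
    calc ‖(-Complex.I / 2)‖ * |V x| ≤ 1 * (C * x⁻¹) := by
          gcongr; exact hV x hx
      _ ≤ _ := by
        rw [one_mul]; gcongr; nlinarith
  · intro x hx
    have hx0 : 0 < x := by linarith
    rw [norm_mul, norm_mul, hnorm2, mul_one, Complex.norm_real, Real.norm_eq_abs]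
    calc ‖(-Complex.I / 2)‖ * |V x| ≤ 1 * (C * x⁻¹) := by
          gcongr; exact hV x hx
      _ ≤ _ := by
        rw [one_mul]; gcongr; nlinarith
  · intro x hx
    have h1 : HasDerivAt (fun x => Complex.exp (-(Complex.I * θ x)))
        (Complex.exp (-(Complex.I * θ x)) * (-(Complex.I * p x))) x :=
      (((hθ x hx).ofReal_comp.const_mul _).neg).cexp
    have h2 : HasDerivAt (fun x => (p x : ℂ) * y x - Complex.I * y' x)
        (p' x * y x + p x * y' x - Complex.I * (-(p x ^ 2 - U x) * y x : ℝ)) x :=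
      ((hpd x hx).ofReal_comp.mul (hy x hx).1.ofReal_comp).sub
      ((hy x hx).2.ofReal_comp.const_mul Complex.I)
    refine (h1.mul h2).congr_deriv ?_
    push_cast
    linear_combination (Complex.exp (-(Complex.I * θ x)) * p x * y' x) * Complex.I_mul_I
  · intro x hx
    have hx0 : 0 < x := by linarith
    have he2 : Complex.exp (-(2 * Complex.I * θ x)) *
        (starRingEnd ℂ) (Complex.exp (-(Complex.I * θ x)) * (p x * y x - Complex.I * y' x))
        = Complex.exp (-(Complex.I * θ x)) * (p x * y x + Complex.I * y' x) := by
      rw [map_mul, ← Complex.exp_conj, ← mul_assoc, ← Complex.exp_add]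
      simp only [map_neg, map_mul, map_sub, Complex.conj_I, Complex.conj_ofReal]
      congr 1
      · congr 1; ring
      · ring
    have e : Complex.exp (-(Complex.I * θ x)) * ((p' x - Complex.I * U x) * y x) -
        (-Complex.I / 2 * V x * (Complex.exp (-(Complex.I * θ x)) *
          (p x * y x - Complex.I * y' x)) +
        -Complex.I / 2 * (V x * Complex.exp (-(2 * Complex.I * θ x))) *
        (starRingEnd ℂ) (Complex.exp (-(Complex.I * θ x)) * (p x * y x - Complex.I * y' x)))
        = Complex.exp (-(Complex.I * θ x)) * (y x * (p' x +
          (-(Complex.I * ((U x - V x : ℝ) : ℂ)) + Complex.I * ((V x * (p x - 1) : ℝ) : ℂ)))) := by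
      rw [show -Complex.I / 2 * (V x * Complex.exp (-(2 * Complex.I * θ x))) *
        (starRingEnd ℂ) (Complex.exp (-(Complex.I * θ x)) * (p x * y x - Complex.I * y' x))
        = -Complex.I / 2 * V x * (Complex.exp (-(2 * Complex.I * θ x)) *
        (starRingEnd ℂ) (Complex.exp (-(Complex.I * θ x)) * (p x * y x - Complex.I * y' x))) by
          ring, he2]
      push_cast
      ring
    have hyw : ‖(y x : ℂ)‖ ≤
        ‖Complex.exp (-(Complex.I * θ x)) * (p x * y x - Complex.I * y' x)‖ := by
      rw [norm_mul, hnorm, one_mul, Complex.norm_real, Real.norm_eq_abs]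
      have h1 := Complex.abs_re_le_norm ((p x : ℂ) * y x - Complex.I * y' x)
      have h2 : ((p x : ℂ) * y x - Complex.I * y' x).re = p x * y x := by simp
      rw [h2, abs_mul, abs_of_nonneg (by linarith [hp x hx])] at h1
      exact (le_mul_of_one_le_left (abs_nonneg _) (hp x hx)).trans h1
    have hrs : x⁻¹ * x ^ (-δ) = x ^ (-1 - δ) := by
      rw [sub_eq_add_neg, Real.rpow_add hx0, Real.rpow_neg_one]
    have hVp : |V x * (p x - 1)| ≤ C ^ 2 * x ^ (-1 - δ) := by
      have h1 : 0 ≤ p x - 1 := by linarith [hp x hx]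
      rw [abs_mul, abs_of_nonneg h1, ← hrs]
      calc |V x| * (p x - 1) ≤ (C * x⁻¹) * (C * x ^ (-δ)) :=
            mul_le_mul (hV x hx) (hp1 x hx) h1 (by positivity)
        _ = _ := by ring
    rw [e, norm_mul, hnorm, one_mul, norm_mul, mul_comm]
    refine mul_le_mul ?_ hyw (norm_nonneg _) (by positivity)
    have b1 : ‖(p' x : ℂ)‖ ≤ C * x ^ (-1 - δ) := by
      rw [Complex.norm_real]; exact hp' x hx
    have b2 : ‖-(Complex.I * ((U x - V x : ℝ) : ℂ))‖ ≤ C * x ^ (-1 - δ) := by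
      rw [norm_neg, norm_mul, Complex.norm_I, one_mul, Complex.norm_real]; exact hUV x hx
    have b3 : ‖Complex.I * ((V x * (p x - 1) : ℝ) : ℂ)‖ ≤ C ^ 2 * x ^ (-1 - δ) := by
      rw [norm_mul, Complex.norm_I, one_mul, Complex.norm_real]; exact hVp
    refine (norm_add_le_of_le b1 (norm_add_le_of_le b2 b3)).trans ?_
    have : 0 ≤ C * x ^ (-1 - δ) := by positivity
    linarith

/-- Every phase is attained by some solution of `y'' = -(p² - U) y`. -/
theorem exists_solution_with_phase (hδ : 0 < δ)
    (hp : ∀ x, 1 < x → 1 ≤ p x) (hp1 : ∀ x, 1 < x → p x - 1 ≤ C * x ^ (-δ))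
    (hpd : ∀ x, 1 < x → HasDerivAt p (p' x) x) (hp' : ∀ x, 1 < x → |p' x| ≤ C * x ^ (-1 - δ))
    (hθ : ∀ x, 1 < x → HasDerivAt θ (p x) x)
    (hV : ∀ x, 1 < x → |V x| ≤ C * x⁻¹) (hUV : ∀ x, 1 < x → |U x - V x| ≤ C * x ^ (-1 - δ))
    (hosc : HasSmallPrimitive δ fun x => V x)
    (hosc2 : HasSmallPrimitive δ fun x => V x * Complex.exp (-(2 * Complex.I * θ x)))
    (hq : ContinuousOn (fun x => -(p x ^ 2 - U x)) (Ici 1)) (τ : ℝ) :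
    ∃ y y' : ℝ → ℝ, ∃ B : ℝ, 0 ≤ B ∧
      (∀ x, 1 < x → HasDerivAt y (y' x) x ∧ HasDerivAt y' (-(p x ^ 2 - U x) * y x) x) ∧
      ∀ x, 2 ≤ x → |y x - Real.cos (θ x - τ)| ≤ B * x ^ (-δ) ∧
        |y' x + Real.sin (θ x - τ)| ≤ B * x ^ (-δ) := by
  have hC : 0 ≤ C := by
    have := (abs_nonneg _).trans (hV 2 one_lt_two)
    exact nonneg_of_mul_nonneg_left this (by positivity)
  obtain ⟨f, f', hf0, hf0', hf⟩ := exists_second_order_solution hq 1 0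
  obtain ⟨g, g', hg0, hg0', hg⟩ := exists_second_order_solution hq 0 1
  obtain ⟨L, B, hB0, hB⟩ :=
    exists_amplitude_limit hδ hp hp1 hpd hp' hθ hV hUV hosc hosc2 hf
  obtain ⟨M, D, hD0, hD⟩ :=
    exists_amplitude_limit hδ hp hp1 hpd hp' hθ hV hUV hosc hosc2 hg
  have hW : ∀ x, 1 < x → f x * g' x - f' x * g x = 1 := by
    have hd : ∀ x, 1 < x → HasDerivAt (fun x => f x * g' x - f' x * g x) 0 x := by
      intro x hx
      refine (((hf x hx).1.mul (hg x hx).2).sub ((hf x hx).2.mul (hg x hx).1)).congr_deriv ?_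
      ring
    intro x hx
    have := isOpen_Ioi.is_const_of_deriv_eq_zero (s := Ioi (1 : ℝ)) isPreconnected_Ioi
      (fun x hx => (hd x hx).differentiableAt.differentiableWithinAt)
      (fun x hx => (hd x hx).deriv) (mem_Ioi.2 hx) (mem_Ioi.2 one_lt_two)
    rw [this, hf0, hf0', hg0, hg0']; norm_num
  have hdecay : Tendsto (fun x : ℝ => x ^ (-δ)) atTop (nhds 0) := tendsto_rpow_neg_atTop hδ
  have hlim : ∀ {w : ℝ → ℂ} {L : ℂ} {B : ℝ}, (∀ x, 2 ≤ x → ‖w x - L‖ ≤ B * x ^ (-δ)) →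
      Tendsto w atTop (nhds L) := by
    intro w L B h
    rw [tendsto_iff_norm_sub_tendsto_zero]
    refine squeeze_zero' (Eventually.of_forall fun _ => norm_nonneg _)
      (eventually_atTop.2 ⟨2, h⟩) ?_
    simpa using hdecay.const_mul B
  have hΔ : ((starRingEnd ℂ) L * M).im ≤ -1 := by
    have h1 := (Complex.continuous_im.tendsto _).comp
      (((Complex.continuous_conj.tendsto _).comp (hlim hB)).mul (hlim hD))
    refine le_of_tendsto h1 (eventually_atTop.2 ⟨2, fun x hx => ?_⟩)
    have hx1 : 1 < x := by linarith
    have e : (starRingEnd ℂ) (Complex.exp (-(Complex.I * θ x)) * (p x * f x - Complex.I * f' x)) *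
        (Complex.exp (-(Complex.I * θ x)) * (p x * g x - Complex.I * g' x))
        = ((p x : ℂ) * f x + Complex.I * f' x) * (p x * g x - Complex.I * g' x) := by
      have : (starRingEnd ℂ) (Complex.exp (-(Complex.I * θ x))) *
          Complex.exp (-(Complex.I * θ x)) = 1 := by
        rw [← Complex.exp_conj, ← Complex.exp_add]
        simp
      simp only [map_mul, map_sub, Complex.conj_I, Complex.conj_ofReal]
      linear_combination (((p x : ℂ) * f x + Complex.I * f' x) *
        (p x * g x - Complex.I * g' x)) * this
    simp only [Function.comp_apply]
    rw [e]
    have : (((p x : ℂ) * f x + Complex.I * f' x) * (p x * g x - Complex.I * g' x)).im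
        = - p x * (f x * g' x - f' x * g x) := by
      simp; ring
    rw [this, hW x hx1]
    linarith [hp x hx1]
  have hΔ' : L.re * M.im - L.im * M.re ≠ 0 := by
    intro h0
    have : ((starRingEnd ℂ) L * M).im = L.re * M.im - L.im * M.re := by simp; ring
    rw [this] at hΔ
    linarith only [hΔ, h0]
  obtain ⟨s, t, hst⟩ : ∃ s t : ℝ, (s : ℂ) * L + t * M = Complex.exp (-(Complex.I * τ)) := by
    refine ⟨((Complex.exp (-(Complex.I * τ))).re * M.im - (Complex.exp (-(Complex.I * τ))).im * M.re)
      / (L.re * M.im - L.im * M.re),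
      (L.re * (Complex.exp (-(Complex.I * τ))).im - L.im * (Complex.exp (-(Complex.I * τ))).re)
      / (L.re * M.im - L.im * M.re), ?_⟩
    generalize Complex.exp (-(Complex.I * τ)) = ℓ
    apply Complex.ext
    · simp only [Complex.add_re, Complex.re_ofReal_mul]
      rw [div_mul_eq_mul_div, div_mul_eq_mul_div, ← add_div, div_eq_iff hΔ']
      ring
    · simp only [Complex.add_im, Complex.im_ofReal_mul]
      rw [div_mul_eq_mul_div, div_mul_eq_mul_div, ← add_div, div_eq_iff hΔ']
      ring
  refine ⟨fun x => s * f x + t * g x, fun x => s * f' x + t * g' x, |s| * B + |t| * D + C,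
    by positivity, ?_, ?_⟩
  · intro x hx
    refine ⟨((hf x hx).1.const_mul s).add ((hg x hx).1.const_mul t), ?_⟩
    refine (((hf x hx).2.const_mul s).add ((hg x hx).2.const_mul t)).congr_deriv ?_
    ring
  · intro x hx
    have hx1 : 1 < x := by linarith
    have hx0 : 0 < x := by linarith
    set e := Complex.exp (-(Complex.I * θ x)) with he
    have hmain : ‖(p x * (s * f x + t * g x : ℝ) - Complex.I * (s * f' x + t * g' x : ℝ)) -
        Complex.exp (((θ x - τ : ℝ) : ℂ) * Complex.I)‖ ≤ (|s| * B + |t| * D) * x ^ (-δ) := by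
      have hn : ‖e‖ = 1 := by
        rw [he, show -(Complex.I * θ x) = ((-θ x : ℝ) : ℂ) * Complex.I by push_cast; ring]
        exact Complex.norm_exp_ofReal_mul_I _
      have h1 : e * Complex.exp (((θ x - τ : ℝ) : ℂ) * Complex.I) = s * L + t * M := by
        rw [hst, he, ← Complex.exp_add]
        congr 1
        push_cast
        ring
      rw [← one_mul ‖_ - _‖, ← hn, ← norm_mul, mul_sub, h1]
      have h2 : e * (p x * (s * f x + t * g x : ℝ) - Complex.I * (s * f' x + t * g' x : ℝ)) -
          (s * L + t * M) = s * (e * (p x * f x - Complex.I * f' x) - L) +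
          t * (e * (p x * g x - Complex.I * g' x) - M) := by
        push_cast; ring
      rw [h2, add_mul]
      refine norm_add_le_of_le ?_ ?_
      · rw [norm_mul, Complex.norm_real, Real.norm_eq_abs, mul_assoc]
        gcongr
        exact hB x hx
      · rw [norm_mul, Complex.norm_real, Real.norm_eq_abs, mul_assoc]
        gcongr
        exact hD x hx
    have hre := (Complex.abs_re_le_norm _).trans hmain
    have him := (Complex.abs_im_le_norm _).trans hmain
    rw [Complex.sub_re, Complex.exp_ofReal_mul_I_re] at hre
    rw [Complex.sub_im, Complex.exp_ofReal_mul_I_im] at him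
    simp only [Complex.sub_re, Complex.sub_im, Complex.re_ofReal_mul, Complex.im_ofReal_mul,
      Complex.I_mul_re, Complex.I_mul_im, Complex.ofReal_re, Complex.ofReal_im, neg_zero, mul_zero,
      sub_zero, zero_sub] at hre him
    have hCx : 0 ≤ C * x ^ (-δ) := by positivity
    constructor
    · have h1 := hp x hx1
      have h2 := hp1 x hx1
      set Y := s * f x + t * g x
      calc |Y - Real.cos (θ x - τ)| ≤ p x * |Y - Real.cos (θ x - τ)| :=
            le_mul_of_one_le_left (abs_nonneg _) h1
        _ = |(p x * Y - Real.cos (θ x - τ)) - (p x - 1) * Real.cos (θ x - τ)| := by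
            rw [← abs_of_nonneg (by linarith : 0 ≤ p x), ← abs_mul,
              abs_of_nonneg (by linarith : 0 ≤ p x)]
            congr 1; ring
        _ ≤ |p x * Y - Real.cos (θ x - τ)| + |(p x - 1) * Real.cos (θ x - τ)| := abs_sub _ _
        _ ≤ (|s| * B + |t| * D) * x ^ (-δ) + C * x ^ (-δ) := by
            refine add_le_add hre ?_
            rw [abs_mul, abs_of_nonneg (by linarith : 0 ≤ p x - 1)]
            exact (mul_le_of_le_one_right (by linarith) (Real.abs_cos_le_one _)).trans h2
        _ = _ := by ring
    · rw [← abs_neg, neg_add, ← sub_eq_add_neg]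
      linarith

end Asymptotics

theorem linearIndependent_of_cos_sin_asymptotics {δ C : ℝ} {θ y₁ y₁' y₂ y₂' : ℝ → ℝ} (hδ : 0 < δ)
    (h₁ : ∀ x, 1 < x → HasDerivAt y₁ (y₁' x) x) (h₂ : ∀ x, 1 < x → HasDerivAt y₂ (y₂' x) x)
    (h : ∀ x, 2 ≤ x → |y₁ x - Real.cos (θ x)| ≤ C * x ^ (-δ) ∧
      |y₁' x + Real.sin (θ x)| ≤ C * x ^ (-δ) ∧ |y₂ x - Real.sin (θ x)| ≤ C * x ^ (-δ) ∧
      |y₂' x - Real.cos (θ x)| ≤ C * x ^ (-δ)) :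
    LinearIndependent ℝ ![y₁, y₂] := by
  rw [LinearIndependent.pair_iff]
  intro s t hst
  have hlim : Tendsto (fun x : ℝ => C * x ^ (-δ)) atTop (nhds 0) := by
    simpa using (tendsto_rpow_neg_atTop hδ).const_mul C
  obtain ⟨x, hx, hx2⟩ := ((hlim.eventually (ge_mem_nhds (show (0 : ℝ) < 1 / 4 by norm_num))).and
    (eventually_ge_atTop 2)).exists
  have e1 : s * y₁ x + t * y₂ x = 0 := congrFun hst x
  have e2 : s * y₁' x + t * y₂' x = 0 := by
    have hd := ((h₁ x (by linarith)).const_mul s).add ((h₂ x (by linarith)).const_mul t)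
    refine hd.unique ?_
    have : ((fun x => s * y₁ x) + fun x => t * y₂ x) = fun _ => (0 : ℝ) :=
      funext fun z => congrFun hst z
    rw [this]
    exact hasDerivAt_const x 0
  obtain ⟨k1, k2, k3, k4⟩ := h x hx2
  have b1 : |s * Real.cos (θ x) + t * Real.sin (θ x)| ≤ (|s| + |t|) * (1 / 4) := by
    rw [show s * Real.cos (θ x) + t * Real.sin (θ x) =
      -(s * (y₁ x - Real.cos (θ x))) - t * (y₂ x - Real.sin (θ x)) by linear_combination e1]
    refine (abs_sub _ _).trans ?_
    rw [abs_neg, abs_mul, abs_mul, add_mul]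
    gcongr
    · exact k1.trans hx
    · exact k3.trans hx
  have b2 : |-s * Real.sin (θ x) + t * Real.cos (θ x)| ≤ (|s| + |t|) * (1 / 4) := by
    rw [show -s * Real.sin (θ x) + t * Real.cos (θ x) =
      -(s * (y₁' x + Real.sin (θ x))) - t * (y₂' x - Real.cos (θ x)) by linear_combination e2]
    refine (abs_sub _ _).trans ?_
    rw [abs_neg, abs_mul, abs_mul, add_mul]
    gcongr
    · exact k2.trans hx
    · exact k4.trans hx
  have q1 := sq_le_sq' (neg_le_of_abs_le b1) (le_of_abs_le b1)
  have q2 := sq_le_sq' (neg_le_of_abs_le b2) (le_of_abs_le b2)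
  have hsq : (s * Real.cos (θ x) + t * Real.sin (θ x)) ^ 2 +
      (-s * Real.sin (θ x) + t * Real.cos (θ x)) ^ 2 = s ^ 2 + t ^ 2 := by
    linear_combination (s ^ 2 + t ^ 2) * Real.sin_sq_add_cos_sq (θ x)
  have hs := sq_abs s
  have ht := sq_abs t
  have : s ^ 2 + t ^ 2 ≤ 0 := by nlinarith [sq_nonneg (|s| - |t|)]
  constructor <;> nlinarith [sq_nonneg s, sq_nonneg t]

/-- The local wave number `√(1 + K / x^γ)`. -/
noncomputable def waveSpeed (γ K x : ℝ) : ℝ := √(1 + K / x ^ γ)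

/-- The phase `∫₀ˣ √(1 + K / s^γ) ds`. -/
noncomputable def wavePhase (γ K x : ℝ) : ℝ := ∫ s in (0 : ℝ)..x, waveSpeed γ K s

section WaveSpeed

variable {γ K : ℝ}

theorem one_le_waveSpeed (hK : 0 < K) {x : ℝ} (hx : 0 ≤ x) : 1 ≤ waveSpeed γ K x := by
  have : 0 ≤ K / x ^ γ := by positivity
  exact Real.one_le_sqrt.2 (by linarith)

theorem waveSpeed_sq (hK : 0 < K) {x : ℝ} (hx : 0 ≤ x) :
    waveSpeed γ K x ^ 2 = 1 + K / x ^ γ :=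
  Real.sq_sqrt (by positivity)

theorem waveSpeed_sub_one_le (hK : 0 < K) {x : ℝ} (hx : 0 ≤ x) :
    waveSpeed γ K x - 1 ≤ K / x ^ γ := by
  nlinarith [one_le_waveSpeed (γ := γ) hK hx, waveSpeed_sq (γ := γ) hK hx]

theorem hasDerivAt_waveSpeed (hK : 0 < K) {x : ℝ} (hx : 0 < x) :
    HasDerivAt (waveSpeed γ K)
      ((K * (-γ * x ^ (-γ - 1))) / (2 * waveSpeed γ K x)) x := by
  have h1 : HasDerivAt (fun x : ℝ => 1 + K * x ^ (-γ)) (K * (-γ * x ^ (-γ - 1))) x :=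
    ((Real.hasDerivAt_rpow_const (Or.inl hx.ne')).const_mul K).const_add 1
  have h2 : (fun x : ℝ => 1 + K / x ^ γ) =ᶠ[nhds x] fun x => 1 + K * x ^ (-γ) := by
    filter_upwards [lt_mem_nhds hx] with y hy
    rw [Real.rpow_neg hy.le, div_eq_mul_inv]
  have h3 := h1.congr_of_eventuallyEq h2
  exact h3.sqrt (by positivity)

theorem abs_deriv_waveSpeed_le (hγ : 0 < γ) (hK : 0 < K) {x : ℝ} (hx : 0 < x) :
    |(K * (-γ * x ^ (-γ - 1))) / (2 * waveSpeed γ K x)| ≤ K * γ * x ^ (-γ - 1) := by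
  have h1 := one_le_waveSpeed (γ := γ) hK hx.le
  rw [abs_div, abs_of_pos (by linarith : 0 < 2 * waveSpeed γ K x)]
  refine (div_le_self (abs_nonneg _) (by linarith)).trans (le_of_eq ?_)
  rw [show K * (-γ * x ^ (-γ - 1)) = -(K * γ * x ^ (-γ - 1)) by ring, abs_neg, abs_of_nonneg]
  positivity

theorem hasDerivAt_wavePhase (hγ1 : γ < 1) (hK : 0 < K) {x : ℝ} (hx : 0 < x) :
    HasDerivAt (wavePhase γ K) (waveSpeed γ K x) x := by
  have hmeas : Measurable (waveSpeed γ K) := by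
    unfold waveSpeed
    fun_prop
  refine intervalIntegral.integral_hasDerivAt_right ?_
    hmeas.stronglyMeasurable.stronglyMeasurableAtFilter (hasDerivAt_waveSpeed hK hx).continuousAt
  have hInt : IntervalIntegrable (fun s : ℝ => 1 + K * s ^ (-γ)) MeasureTheory.volume 0 x :=
    intervalIntegrable_const.add
      ((intervalIntegral.intervalIntegrable_rpow' (by linarith)).const_mul K)
  refine hInt.mono_fun hmeas.aestronglyMeasurable ?_
  refine (MeasureTheory.ae_restrict_iff' measurableSet_uIoc).2 (Eventually.of_forall ?_)
  intro s hs
  rw [uIoc_of_le hx.le] at hs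
  have h1 := one_le_waveSpeed (γ := γ) hK hs.1.le
  have h2 := waveSpeed_sub_one_le (γ := γ) hK hs.1.le
  have h3 : 0 < s ^ (-γ) := Real.rpow_pos_of_pos hs.1 _
  change ‖waveSpeed γ K s‖ ≤ ‖1 + K * s ^ (-γ)‖
  rw [Real.norm_of_nonneg (by linarith), Real.norm_of_nonneg (by positivity),
    Real.rpow_neg hs.1.le, ← div_eq_mul_inv]
  linarith

/-- Lower bound for the frequency gap `|p_K + σ p_{K'}|`, `σ ∈ {-1, 0, 1}`. -/
theorem exists_lower_bound_waveSpeed_add (hγ : 0 < γ) {K' : ℝ} (hK : 0 < K) (hK' : 0 < K')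
    (hne : K ≠ K') {σ : ℝ} (hσ : σ = -1 ∨ 0 ≤ σ) :
    ∃ d > 0, ∀ x, 1 < x → d * x ^ (-γ) ≤ |waveSpeed γ K x + σ * waveSpeed γ K' x| := by
  rcases hσ with rfl | hσ
  · refine ⟨|K - K'| / (2 + K + K'), div_pos (abs_pos.2 (sub_ne_zero.2 hne)) (by positivity),
      fun x hx => ?_⟩
    have hx0 : 0 < x := by linarith
    have a1 := one_le_waveSpeed (γ := γ) hK hx0.le
    have a2 := one_le_waveSpeed (γ := γ) hK' hx0.le
    have hxγ : 1 ≤ x ^ γ := Real.one_le_rpow hx.le hγ.le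
    have b1 := (waveSpeed_sub_one_le (γ := γ) hK hx0.le).trans (div_le_self hK.le hxγ)
    have b2 := (waveSpeed_sub_one_le (γ := γ) hK' hx0.le).trans (div_le_self hK'.le hxγ)
    have e : (waveSpeed γ K x + -1 * waveSpeed γ K' x) * (waveSpeed γ K x + waveSpeed γ K' x)
        = (K - K') * x ^ (-γ) := by
      rw [Real.rpow_neg hx0.le]
      linear_combination waveSpeed_sq (γ := γ) hK hx0.le - waveSpeed_sq (γ := γ) hK' hx0.le
    have e' := congrArg abs e
    rw [abs_mul, abs_mul, abs_of_pos (by linarith : 0 < waveSpeed γ K x + waveSpeed γ K' x),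
      abs_of_pos (Real.rpow_pos_of_pos hx0 (-γ))] at e'
    rw [div_mul_eq_mul_div, div_le_iff₀ (by positivity), ← e']
    exact mul_le_mul_of_nonneg_left (by linarith) (abs_nonneg _)
  · refine ⟨1, one_pos, fun x hx => ?_⟩
    have hx0 : 0 < x := by linarith
    have a1 := one_le_waveSpeed (γ := γ) hK hx0.le
    have a2 := one_le_waveSpeed (γ := γ) hK' hx0.le
    have hs1 : x ^ (-γ) ≤ 1 := Real.rpow_le_one_of_one_le_of_nonpos hx.le (by linarith)
    have : 0 ≤ σ * waveSpeed γ K' x := mul_nonneg hσ (by linarith)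
    rw [one_mul, abs_of_pos (by linarith)]
    linarith

theorem hasSmallPrimitive_wavePhase (hγ : 0 < γ) (hγ1 : γ < 1) {δ K' : ℝ} (hδ : δ ≤ 1 - γ)
    (hK : 0 < K) (hK' : 0 < K') (hne : K ≠ K') {σ : ℝ} (hσ : σ = -1 ∨ 0 ≤ σ) (τ : ℝ) :
    HasSmallPrimitive δ fun x => (x : ℂ)⁻¹ * Complex.exp (Complex.I *
      ((2 * wavePhase γ K x + 2 * τ + σ * (2 * wavePhase γ K' x) : ℝ) : ℂ)) := by
  obtain ⟨d, hd, hlow⟩ := exists_lower_bound_waveSpeed_add hγ hK hK' hne hσ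
  refine hasSmallPrimitive_exp (γ := γ) (d := 2 * d) (C := 2 * (K * γ) + |σ| * (2 * (K' * γ)))
    (by positivity) hδ
    (D := fun x => 2 * waveSpeed γ K x + σ * (2 * waveSpeed γ K' x))
    (D' := fun x => 2 * ((K * (-γ * x ^ (-γ - 1))) / (2 * waveSpeed γ K x)) +
      σ * (2 * ((K' * (-γ * x ^ (-γ - 1))) / (2 * waveSpeed γ K' x)))) ?_ ?_ ?_ ?_
  · intro x hx
    have hx0 : 0 < x := by linarith
    exact (((hasDerivAt_wavePhase hγ1 hK hx0).const_mul 2).add_const _).add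
      (((hasDerivAt_wavePhase hγ1 hK' hx0).const_mul 2).const_mul σ)
  · intro x hx
    have hx0 : 0 < x := by linarith
    exact ((hasDerivAt_waveSpeed hK hx0).const_mul 2).add
      (((hasDerivAt_waveSpeed hK' hx0).const_mul 2).const_mul σ)
  · intro x hx
    have e : 2 * waveSpeed γ K x + σ * (2 * waveSpeed γ K' x) =
      2 * (waveSpeed γ K x + σ * waveSpeed γ K' x) := by ring
    rw [e, abs_mul, abs_two, mul_assoc]
    gcongr
    exact hlow x hx
  · intro x hx
    have hx0 : 0 < x := by linarith
    refine (abs_add_le _ _).trans ?_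
    rw [abs_mul, abs_mul, abs_mul, abs_two]
    calc _ ≤ 2 * (K * γ * x ^ (-γ - 1)) + |σ| * (2 * (K' * γ * x ^ (-γ - 1))) := by
          gcongr
          · exact abs_deriv_waveSpeed_le hγ hK hx0
          · exact abs_deriv_waveSpeed_le hγ hK' hx0
      _ = _ := by ring

/-- A Wigner–von Neumann potential twisted by a non-resonant phase has a small primitive. -/
theorem hasSmallPrimitive_wignerVonNeumann (hγ : 0 < γ) (hγ1 : γ < 1) {δ K₀ : ℝ} (hδ : δ ≤ 1 - γ)
    {ι : Type*} [Fintype ι] {κ : ι → ℝ} (hκ : ∀ j, 0 < κ j) (hK₀ : 0 < K₀) (hne : ∀ j, κ j ≠ K₀)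
    (t : ι → ℝ) (a : ℝ) {σ : ℝ} (hσ : σ = 0 ∨ σ = 1) :
    HasSmallPrimitive δ fun x =>
      (((4 * a / x) * ∑ j, Real.sin (2 * wavePhase γ (κ j) x + 2 * t j) : ℝ) : ℂ) *
        Complex.exp (-(2 * Complex.I * ((σ * wavePhase γ K₀ x : ℝ) : ℂ))) := by
  have hσ' : -σ = -1 ∨ 0 ≤ -σ := by rcases hσ with rfl | rfl <;> simp
  have hσ'' : σ = -1 ∨ 0 ≤ σ := by rcases hσ with rfl | rfl <;> simp
  have h := HasSmallPrimitive.sum Finset.univ fun j =>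
    ((hasSmallPrimitive_wavePhase hγ hγ1 hδ (hκ j) hK₀ (hne j) hσ' (t j)).const_mul
      (-2 * a * Complex.I)).add
    ((hasSmallPrimitive_wavePhase hγ hγ1 hδ (hκ j) hK₀ (hne j) hσ'' (t j)).conj.const_mul
      (2 * a * Complex.I))
  refine h.congr fun x _ => ?_
  push_cast
  rw [Finset.mul_sum, Finset.sum_mul]
  refine Finset.sum_congr rfl fun j _ => ?_
  rw [map_mul, ← Complex.exp_conj, map_inv₀, Complex.sin]
  simp only [map_mul, map_add, Complex.conj_I, Complex.conj_ofReal, map_ofNat]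
  generalize (wavePhase γ (κ j) x : ℂ) = θ
  generalize (wavePhase γ K₀ x : ℂ) = θ₀
  have e1 : Complex.exp (Complex.I * (2 * θ + 2 * t j + -σ * (2 * θ₀))) =
      Complex.exp ((2 * θ + 2 * t j) * Complex.I) * Complex.exp (-(2 * Complex.I * (σ * θ₀))) := by
    rw [← Complex.exp_add]; congr 1; ring
  have e2 : Complex.exp (-Complex.I * (2 * θ + 2 * t j + σ * (2 * θ₀))) =
      Complex.exp (-(2 * θ + 2 * t j) * Complex.I) * Complex.exp (-(2 * Complex.I * (σ * θ₀))) := by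
    rw [← Complex.exp_add]; congr 1; ring
  rw [e1, e2]
  ring

end WaveSpeed

/-- Theorem 3.1, non-resonant case: with the generalized Wigner–von Neumann
potential `V` built from distinct positive energies `E_1, …, E_N` and phases `t_j`, for any
`E > 0` not among the `E_j`, the equation `-y'' + Q(·,E) y = y` on `(1,∞)` has two linearly
independent solutions asymptotic to `cos(∫₀^ξ √(1-β_E) + t)` and `sin(∫₀^ξ √(1-β_E) + t)`
with errors `O(ξ^{-ε})`. -/
theorem stmt6 (α : ℝ) (hα0 : 0 < α) (hα2 : α < 2)
    (a : ℝ) (ha : 0 < a)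
    (N : ℕ) (E : Fin N → ℝ) (hEpos : ∀ j, 0 < E j) (hEinj : Function.Injective E)
    (t : Fin N → ℝ)
    (c : ℝ) (hc : c = (1 + α / 2) ^ ((2 : ℝ) / (2 + α)))
    (β : ℝ → ℝ → ℝ) (hβ : ∀ e x : ℝ, β e x = -e / (c ^ α * x ^ (2 * α / (2 + α))))
    (V : ℝ → ℝ)
    (hV : ∀ ξ : ℝ, V ξ = if ξ ≤ 1 then 0 else
      (4 * a / ξ) * ∑ j : Fin N,
        Real.sin (2 * (∫ x in (0 : ℝ)..ξ, Real.sqrt (1 - β (E j) x)) + 2 * t j))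
    (Q : ℝ → ℝ → ℝ)
    (hQ : ∀ ξ e : ℝ, Q ξ e =
      (α * (α - 1) / (2 + α) ^ 2 - 5 / 4 * α ^ 2 / (2 + α) ^ 2) * ξ ^ (-(2 : ℝ))
        + β e ξ + V ξ)
    (E₀ : ℝ) (hE₀ : 0 < E₀) (hE₀ne : ∀ j, E₀ ≠ E j) :
    ∃ tph : ℝ, ∃ C > (0 : ℝ), ∃ ε > (0 : ℝ), ∃ y₁ y₁' y₂ y₂' : ℝ → ℝ,
      (∀ ξ ∈ Ioi (1 : ℝ), HasDerivAt y₁ (y₁' ξ) ξ ∧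
        HasDerivAt y₁' ((Q ξ E₀ - 1) * y₁ ξ) ξ) ∧
      (∀ ξ ∈ Ioi (1 : ℝ), HasDerivAt y₂ (y₂' ξ) ξ ∧
        HasDerivAt y₂' ((Q ξ E₀ - 1) * y₂ ξ) ξ) ∧
      LinearIndependent ℝ ![y₁, y₂] ∧
      ∀ ξ : ℝ, 2 ≤ ξ →
        |y₁ ξ - Real.cos ((∫ x in (0 : ℝ)..ξ, Real.sqrt (1 - β E₀ x)) + tph)|
            ≤ C * ξ ^ (-ε) ∧
        |y₁' ξ + Real.sin ((∫ x in (0 : ℝ)..ξ, Real.sqrt (1 - β E₀ x)) + tph)|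
            ≤ C * ξ ^ (-ε) ∧
        |y₂ ξ - Real.sin ((∫ x in (0 : ℝ)..ξ, Real.sqrt (1 - β E₀ x)) + tph)|
            ≤ C * ξ ^ (-ε) ∧
        |y₂' ξ - Real.cos ((∫ x in (0 : ℝ)..ξ, Real.sqrt (1 - β E₀ x)) + tph)|
            ≤ C * ξ ^ (-ε) := by
  have hγ : 0 < 2 * α / (2 + α) := by positivity
  have hγ1 : 2 * α / (2 + α) < 1 := by rw [div_lt_one (by linarith)]; linarith
  obtain ⟨γ, hγdef⟩ : ∃ γ, 2 * α / (2 + α) = γ := ⟨_, rfl⟩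
  obtain ⟨k, hk⟩ : ∃ k, α * (α - 1) / (2 + α) ^ 2 - 5 / 4 * α ^ 2 / (2 + α) ^ 2 = k := ⟨_, rfl⟩
  rw [hγdef] at hγ hγ1
  have hc0 : 0 < c := by rw [hc]; positivity
  have hcα : 0 < c ^ α := Real.rpow_pos_of_pos hc0 _
  have hβ' : ∀ e x, 1 - β e x = 1 + e / c ^ α / x ^ γ := fun e x => by
    rw [hβ, hγdef, div_div, neg_div, sub_neg_eq_add]
  have hphase : ∀ e ξ, ∫ x in (0 : ℝ)..ξ, √(1 - β e x) = wavePhase γ (e / c ^ α) ξ := fun e ξ => by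
    simp only [hβ', wavePhase, waveSpeed]
  simp only [hphase] at hV ⊢
  obtain ⟨K₀, hK₀def⟩ : ∃ K₀, E₀ / c ^ α = K₀ := ⟨_, rfl⟩
  have hK₀ : 0 < K₀ := hK₀def ▸ div_pos hE₀ hcα
  have hκ : ∀ j, 0 < E j / c ^ α := fun j => div_pos (hEpos j) hcα
  have hne : ∀ j, E j / c ^ α ≠ K₀ := fun j h =>
    hE₀ne j ((div_left_inj' hcα.ne').1 (hK₀def.trans h.symm))
  rw [hK₀def]
  have hδ : 0 < min γ (1 - γ) := lt_min hγ (by linarith)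
  have hδγ : min γ (1 - γ) ≤ γ := min_le_left _ _
  have hδγ1 : min γ (1 - γ) ≤ 1 - γ := min_le_right _ _
  generalize min γ (1 - γ) = δ at hδ hδγ hδγ1
  let W : ℝ → ℝ := fun x =>
    (4 * a / x) * ∑ j, Real.sin (2 * wavePhase γ (E j / c ^ α) x + 2 * t j)
  let U : ℝ → ℝ := fun x => k * x ^ (-(2 : ℝ)) + W x
  have hWb : ∀ x, 1 < x → |W x| ≤ 4 * a * N * x⁻¹ := fun x hx => by
    have hx0 : 0 < x := by linarith
    have hs : |∑ j, Real.sin (2 * wavePhase γ (E j / c ^ α) x + 2 * t j)| ≤ N := by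
      refine (Finset.abs_sum_le_sum_abs _ _).trans ?_
      refine (Finset.sum_le_sum fun j _ => Real.abs_sin_le_one _).trans ?_
      simp
    calc |W x| = 4 * a / x * |∑ j, Real.sin (2 * wavePhase γ (E j / c ^ α) x + 2 * t j)| := by
          rw [abs_mul, abs_of_pos (by positivity : 0 < 4 * a / x)]
      _ ≤ 4 * a / x * N := by gcongr
      _ = _ := by ring
  have hQU : ∀ x, 1 < x → Q x E₀ - 1 = -(waveSpeed γ K₀ x ^ 2 - U x) := fun x hx => by
    have hb := hβ' E₀ x
    rw [hK₀def] at hb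
    rw [hQ, hk, hV, if_neg hx.not_ge, waveSpeed_sq hK₀ (by linarith)]
    simp only [U, W]
    linarith
  obtain ⟨C, hC1, hC2, hC3, hC4⟩ :
      ∃ C, K₀ ≤ C ∧ K₀ * γ ≤ C ∧ 4 * a * N ≤ C ∧ |k| ≤ C := by
    have h1 : 0 ≤ K₀ * γ := by positivity
    have h2 : 0 ≤ 4 * a * N := by positivity
    have h3 := abs_nonneg k
    exact ⟨K₀ + K₀ * γ + 4 * a * N + |k|, by linarith, by linarith, by linarith, by linarith⟩
  have hC0 : 0 ≤ C := hK₀.le.trans hC1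
  have hp1 : ∀ x, 1 < x → waveSpeed γ K₀ x - 1 ≤ C * x ^ (-δ) := fun x hx => by
    have hx0 : 0 < x := by linarith
    refine (waveSpeed_sub_one_le hK₀ hx0.le).trans ?_
    rw [div_eq_mul_inv, ← Real.rpow_neg hx0.le]
    have := Real.rpow_le_rpow_of_exponent_le hx.le (neg_le_neg hδγ)
    gcongr
  have hp' : ∀ x, 1 < x → |(K₀ * (-γ * x ^ (-γ - 1))) / (2 * waveSpeed γ K₀ x)| ≤
      C * x ^ (-1 - δ) := fun x hx => by
    have hx0 : 0 < x := by linarith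
    refine (abs_deriv_waveSpeed_le hγ hK₀ hx0).trans ?_
    have := Real.rpow_le_rpow_of_exponent_le hx.le (by linarith : -γ - 1 ≤ -1 - δ)
    gcongr
  have hWC : ∀ x, 1 < x → |W x| ≤ C * x⁻¹ := fun x hx => by
    have hx0 : 0 < x := by linarith
    refine (hWb x hx).trans ?_
    gcongr
  have hUW : ∀ x, 1 < x → |U x - W x| ≤ C * x ^ (-1 - δ) := fun x hx => by
    have hx0 : 0 < x := by linarith
    have e : U x - W x = k * x ^ (-(2 : ℝ)) := by simp [U]
    rw [e, abs_mul, abs_of_pos (Real.rpow_pos_of_pos hx0 _)]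
    have := Real.rpow_le_rpow_of_exponent_le hx.le (by linarith : -(2 : ℝ) ≤ -1 - δ)
    gcongr
  have hosc : HasSmallPrimitive δ fun x => (W x : ℂ) := by
    refine (hasSmallPrimitive_wignerVonNeumann hγ hγ1 hδγ1 hκ hK₀ hne t a
      (Or.inl rfl)).congr fun x _ => ?_
    simp [W]
  have hosc2 : HasSmallPrimitive δ fun x =>
      W x * Complex.exp (-(2 * Complex.I * wavePhase γ K₀ x)) := by
    refine (hasSmallPrimitive_wignerVonNeumann hγ hγ1 hδγ1 hκ hK₀ hne t a
      (Or.inr rfl)).congr fun x _ => ?_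
    simp only [W, one_mul]
  have hq : ContinuousOn (fun x => -(waveSpeed γ K₀ x ^ 2 - U x)) (Ici 1) := by
    intro x hx
    have hx0 : 0 < x := one_pos.trans_le hx
    have h1 := (hasDerivAt_waveSpeed (γ := γ) hK₀ hx0).continuousAt
    have h2 : ContinuousAt W x := by
      refine (continuousAt_const.div continuousAt_id hx0.ne').mul ?_
      refine tendsto_finsetSum _ fun j _ => ?_
      have h3 := (hasDerivAt_wavePhase hγ1 (hκ j) hx0).continuousAt
      exact Real.continuous_sin.continuousAt.comp
        ((continuousAt_const.mul h3).add continuousAt_const)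
    have h4 : ContinuousAt (fun x : ℝ => x ^ (-(2 : ℝ))) x :=
      Real.continuousAt_rpow_const _ _ (Or.inl hx0.ne')
    exact (((h1.pow 2).sub ((continuousAt_const.mul h4).add h2)).neg).continuousWithinAt
  have key := exists_solution_with_phase hδ
    (fun x hx => one_le_waveSpeed (γ := γ) hK₀ (by linarith)) hp1
    (fun x hx => hasDerivAt_waveSpeed hK₀ (by linarith)) hp'
    (fun x hx => hasDerivAt_wavePhase hγ1 hK₀ (by linarith)) hWC hUW hosc hosc2 hq
  obtain ⟨y₁, y₁', B₁, hB₁, hy₁, hb₁⟩ := key 0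
  obtain ⟨y₂, y₂', B₂, hB₂, hy₂, hb₂⟩ := key (Real.pi / 2)
  have hbounds : ∀ ξ : ℝ, 2 ≤ ξ →
      |y₁ ξ - Real.cos (wavePhase γ K₀ ξ)| ≤ (B₁ + B₂ + 1) * ξ ^ (-δ) ∧
      |y₁' ξ + Real.sin (wavePhase γ K₀ ξ)| ≤ (B₁ + B₂ + 1) * ξ ^ (-δ) ∧
      |y₂ ξ - Real.sin (wavePhase γ K₀ ξ)| ≤ (B₁ + B₂ + 1) * ξ ^ (-δ) ∧
      |y₂' ξ - Real.cos (wavePhase γ K₀ ξ)| ≤ (B₁ + B₂ + 1) * ξ ^ (-δ) := fun ξ hξ => by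
    have h1 := hb₁ ξ hξ
    have h2 := hb₂ ξ hξ
    rw [sub_zero] at h1
    rw [Real.cos_sub_pi_div_two, Real.sin_sub_pi_div_two, ← sub_eq_add_neg] at h2
    have hξ0 : 0 < ξ ^ (-δ) := Real.rpow_pos_of_pos (by linarith) _
    have m1 : B₁ * ξ ^ (-δ) ≤ (B₁ + B₂ + 1) * ξ ^ (-δ) := by gcongr; linarith
    have m2 : B₂ * ξ ^ (-δ) ≤ (B₁ + B₂ + 1) * ξ ^ (-δ) := by gcongr; linarith
    exact ⟨h1.1.trans m1, h1.2.trans m1, h2.1.trans m2, h2.2.trans m2⟩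
  refine ⟨0, B₁ + B₂ + 1, by positivity, δ, hδ, y₁, y₁', y₂, y₂', fun ξ hξ => ?_, fun ξ hξ => ?_,
    linearIndependent_of_cos_sin_asymptotics hδ (fun x hx => (hy₁ x hx).1)
      (fun x hx => (hy₂ x hx).1) hbounds, fun ξ hξ => ?_⟩
  · rw [hQU ξ hξ]
    exact hy₁ ξ hξ
  · rw [hQU ξ hξ]
    exact hy₂ ξ hξ
  · rw [add_zero]
    exact hbounds ξ hξ
end
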